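/- arXiv:1308.0423 — 4 statements merged into one kernel-verified Lean document; each statement's English description precedes it below -/
import Mathlib

section
/- Let k be any field and let a, b be nonzero elements of k. Let σ be the k-automorphism of the rational function field k(x₁,x₂) defined by σ(x₁) = a/x₁ and σ(x₂) = b/x₂. Then the fixed field k(x₁,x₂)^⟨σ⟩ equals k(u,v), where u = (x₁ − a/x₁)/(x₁x₂ − ab/(x₁x₂)) and v = (x₂ − b/x₂)/(x₁x₂ − ab/(x₁x₂)). In particular, k(x₁,x₂)^⟨σ⟩ is purely transcendental over k. -/
/-- An intermediate field `L` of `E/k` is purely transcendental (rational) over `k`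
if `L = k(s)` for some set `s` of elements algebraically independent over `k`. -/
def IsRationalExtension (k : Type*) {E : Type*} [Field k] [Field E] [Algebra k E]
    (L : IntermediateField k E) : Prop :=
  ∃ s : Set E, AlgebraicIndependent k ((↑) : s → E) ∧ IntermediateField.adjoin k s = L

open IntermediateField in
/-- If `E` is generated over `k` by elements of `F + F x`, where `x + σ x` and `x * σ x` lie in `F`
for an automorphism `σ` fixing `F`, then `E = F + F x`. -/
theorem IntermediateField.exists_eq_add_mul_of_adjoin_eq_top {k E : Type*} [Field k] [Field E]
    [Algebra k E] {F : IntermediateField k E} {σ : E ≃ₐ[k] E} {x : E} {S : Set E}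
    (hF : ∀ z ∈ F, σ z = z) (htr : x + σ x ∈ F) (hnorm : x * σ x ∈ F)
    (hS : adjoin k S = ⊤) (hSF : ∀ z ∈ S, ∃ p ∈ F, ∃ q ∈ F, z = p + q * x) (z : E) :
    ∃ p ∈ F, ∃ q ∈ F, z = p + q * x := by
  have hz : z ∈ adjoin k S := hS ▸ mem_top
  induction hz using adjoin_induction with
  | mem z hz => exact hSF z hz
  | algebraMap c => exact ⟨_, F.algebraMap_mem c, 0, F.zero_mem, by ring⟩
  | add y z _ _ hy hz =>
    obtain ⟨p, hp, q, hq, rfl⟩ := hy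
    obtain ⟨r, hr, s, hs, rfl⟩ := hz
    exact ⟨p + r, add_mem hp hr, q + s, add_mem hq hs, by ring⟩
  | mul y z _ _ hy hz =>
    obtain ⟨p, hp, q, hq, rfl⟩ := hy
    obtain ⟨r, hr, s, hs, rfl⟩ := hz
    exact ⟨p * r - q * s * (x * σ x), sub_mem (mul_mem hp hr) (mul_mem (mul_mem hq hs) hnorm),
      p * s + q * r + q * s * (x + σ x),
      add_mem (add_mem (mul_mem hp hs) (mul_mem hq hr)) (mul_mem (mul_mem hq hs) htr), by ring⟩
  | inv z _ hz =>
    obtain ⟨p, hp, q, hq, rfl⟩ := hz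
    by_cases h0 : p + q * x = 0
    · exact ⟨0, F.zero_mem, 0, F.zero_mem, by simp [h0]⟩
    have h1 : p + q * σ x ≠ 0 := by
      have := (map_ne_zero σ).2 h0
      rwa [map_add, map_mul, hF p hp, hF q hq] at this
    have hN : (p + q * x) * (p + q * σ x) ∈ F := by
      rw [show (p + q * x) * (p + q * σ x) = p * p + p * q * (x + σ x) + q * q * (x * σ x) by ring]
      exact add_mem (add_mem (mul_mem hp hp) (mul_mem (mul_mem hp hq) htr))
        (mul_mem (mul_mem hq hq) hnorm)
    refine ⟨(p + q * (x + σ x)) / ((p + q * x) * (p + q * σ x)),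
      div_mem (add_mem hp (mul_mem hq htr)) hN, -q / ((p + q * x) * (p + q * σ x)),
      div_mem (neg_mem hq) hN, ?_⟩
    field_simp
    ring

/-- A fixed element of `F + F x` lies in `F` as soon as `x` is moved. -/
theorem IntermediateField.fixedField_zpowers_eq {k E : Type*} [Field k] [Field E]
    [Algebra k E] {F : IntermediateField k E} {σ : E ≃ₐ[k] E} {x : E}
    (hF : ∀ z ∈ F, σ z = z) (hx : σ x ≠ x) (hspan : ∀ z : E, ∃ p ∈ F, ∃ q ∈ F, z = p + q * x) :
    fixedField (Subgroup.zpowers σ) = F := by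
  refine le_antisymm (fun z hz ↦ ?_) ?_
  · have hσz : σ z = z := (mem_fixedField_iff _ z).1 hz σ (Subgroup.mem_zpowers σ)
    obtain ⟨p, hp, q, hq, rfl⟩ := hspan z
    rw [map_add, map_mul, hF p hp, hF q hq] at hσz
    have : q * (σ x - x) = 0 := by linear_combination hσz
    rcases mul_eq_zero.1 this with rfl | h
    · simpa using hp
    · exact absurd (sub_eq_zero.1 h) hx
  · rw [le_iff_le, Subgroup.zpowers_le]
    exact (mem_fixingSubgroup_iff F σ).2 hF

open IntermediateField in
/-- If `E` is algebraic over `k(u, v)` and contains two algebraically independent elements, then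
`u` and `v` are algebraically independent. -/
theorem AlgebraicIndependent.pair_of_isAlgebraic_adjoin {k E : Type*} [Field k] [Field E]
    [Algebra k E] {x : Fin 2 → E} (hx : AlgebraicIndependent k x) {u v : E}
    [halg : Algebra.IsAlgebraic (adjoin k {u, v}) E] : AlgebraicIndependent k ![u, v] := by
  have : Algebra.IsAlgebraic (Algebra.adjoin k (Set.range ![u, v])) E := by
    rw [Matrix.range_cons_cons_empty]
    exact IntermediateField.isAlgebraic_adjoin_iff_top.1 halg
  exact (Algebra.IsAlgebraic.isTranscendenceBasis_of_lift_le_trdeg_of_finite k _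
    hx.lift_cardinalMk_le_trdeg).1

/-- Let `σ` be the `k`-automorphism of `k(x₁,x₂)` with `σ(x₁) = a/x₁`, `σ(x₂) = b/x₂`
for nonzero `a, b ∈ k`.  Then the fixed field `k(x₁,x₂)^⟨σ⟩` equals `k(u, v)` with
`u = (x₁ - a/x₁)/(x₁x₂ - ab/(x₁x₂))`, `v = (x₂ - b/x₂)/(x₁x₂ - ab/(x₁x₂))`;
in particular it is purely transcendental over `k`. -/
theorem fixed_field_involution_two_variables
    (k K : Type*) [Field k] [Field K] [Algebra k K]
    (x₁ x₂ : K) (hx : AlgebraicIndependent k ![x₁, x₂])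
    (hgen : IntermediateField.adjoin k {x₁, x₂} = ⊤)
    (a b : k) (ha : a ≠ 0) (hb : b ≠ 0)
    (σ : K ≃ₐ[k] K)
    (hσ1 : σ x₁ = algebraMap k K a / x₁) (hσ2 : σ x₂ = algebraMap k K b / x₂) :
    IntermediateField.fixedField (Subgroup.zpowers σ) =
      IntermediateField.adjoin k
        {(x₁ - algebraMap k K a / x₁) /
            (x₁ * x₂ - algebraMap k K (a * b) / (x₁ * x₂)),
         (x₂ - algebraMap k K b / x₂) /
            (x₁ * x₂ - algebraMap k K (a * b) / (x₁ * x₂))} ∧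
    IsRationalExtension k (IntermediateField.fixedField (Subgroup.zpowers σ)) := by
  have hinj (p q : MvPolynomial (Fin 2) k) (c : Fin 2 → k)
      (h : MvPolynomial.eval c p ≠ MvPolynomial.eval c q) :
      MvPolynomial.aeval ![x₁, x₂] p ≠ MvPolynomial.aeval ![x₁, x₂] q :=
    fun hpq ↦ h (congrArg _ (hx hpq))
  have hx₁ : x₁ ≠ 0 := by
    simpa using hinj (.X 0) 0 1 (by simp)
  have hx₂ : x₂ ≠ 0 := by
    simpa using hinj (.X 1) 0 1 (by simp)
  have hD : x₁ ^ 2 * x₂ ^ 2 - algebraMap k K a * algebraMap k K b ≠ 0 := sub_ne_zero.2 <| by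
    have h := hinj (.X 0 ^ 2 * .X 1 ^ 2) (.C a * .C b) 0 (by simp [ha, hb])
    simpa using h
  have hA : x₁ ^ 2 - algebraMap k K a ≠ 0 := sub_ne_zero.2 <| by
    have h := hinj (.X 0 ^ 2) (.C a) 0 (by simp [ha.symm])
    simpa using h
  have hB : x₂ ^ 2 - algebraMap k K b ≠ 0 := sub_ne_zero.2 <| by
    have h := hinj (.X 1 ^ 2) (.C b) 0 (by simp [hb.symm])
    simpa using h
  have ha' : algebraMap k K a ≠ 0 := (map_ne_zero _).2 ha
  have hb' : algebraMap k K b ≠ 0 := (map_ne_zero _).2 hb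
  have haF := fun F : IntermediateField k K ↦ F.algebraMap_mem a
  have hbF := fun F : IntermediateField k K ↦ F.algebraMap_mem b
  have hσa : σ (algebraMap k K a) = algebraMap k K a := σ.commutes a
  have hσb : σ (algebraMap k K b) = algebraMap k K b := σ.commutes b
  rw [map_mul]
  generalize algebraMap k K a = α at *
  generalize algebraMap k K b = β at *
  obtain ⟨u, hu⟩ : ∃ u, u = (x₁ - α / x₁) / (x₁ * x₂ - α * β / (x₁ * x₂)) := ⟨_, rfl⟩
  obtain ⟨v, hv⟩ : ∃ v, v = (x₂ - β / x₂) / (x₁ * x₂ - α * β / (x₁ * x₂)) := ⟨_, rfl⟩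
  have hu' : u = x₂ * (x₁ ^ 2 - α) / (x₁ ^ 2 * x₂ ^ 2 - α * β) := by
    rw [hu, show x₁ * x₂ - α * β / (x₁ * x₂) = (x₁ ^ 2 * x₂ ^ 2 - α * β) / (x₁ * x₂) by
      field_simp]
    field_simp
  have hv' : v = x₁ * (x₂ ^ 2 - β) / (x₁ ^ 2 * x₂ ^ 2 - α * β) := by
    rw [hv, show x₁ * x₂ - α * β / (x₁ * x₂) = (x₁ ^ 2 * x₂ ^ 2 - α * β) / (x₁ * x₂) by
      field_simp]
    field_simp
  have hσu : σ u = u := by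
    simp only [hu, map_div₀, map_sub, map_mul, hσ1, hσ2, hσa, hσb]
    rw [← neg_div_neg_eq]
    congr 1 <;> field_simp <;> ring
  have hσv : σ v = v := by
    simp only [hv, map_div₀, map_sub, map_mul, hσ1, hσ2, hσa, hσb]
    rw [← neg_div_neg_eq]
    congr 1 <;> field_simp <;> ring
  rw [← hu, ← hv]
  have hu0 : u ≠ 0 := hu' ▸ div_ne_zero (mul_ne_zero hx₂ hA) hD
  have hv0 : v ≠ 0 := hv' ▸ div_ne_zero (mul_ne_zero hx₁ hB) hD
  have hxσ : σ x₁ ≠ x₁ := by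
    rw [hσ1, Ne, div_eq_iff hx₁]
    exact fun h ↦ hA (by linear_combination -h)
  have huF : u ∈ IntermediateField.adjoin k {u, v} :=
    IntermediateField.subset_adjoin k _ (Set.mem_insert u _)
  have hvF : v ∈ IntermediateField.adjoin k {u, v} :=
    IntermediateField.subset_adjoin k _ (Set.mem_insert_of_mem u rfl)
  have hF : ∀ z ∈ IntermediateField.adjoin k {u, v}, σ z = z := by
    refine (IntermediateField.forall_mem_adjoin_smul_eq_self_iff k σ).2 ?_
    rintro z (rfl | rfl) <;> assumption
  have hnorm : x₁ * σ x₁ = α := by rw [hσ1]; field_simp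
  have htr : x₁ + σ x₁ = (1 + α * v ^ 2 - β * u ^ 2) / v := by
    rw [hσ1, eq_div_iff hv0, hu', hv']
    field_simp
    ring
  have hx₂_eq : x₂ = (1 - v * σ x₁) / u := by
    rw [eq_div_iff hu0]
    apply mul_left_cancel₀ hD
    linear_combination x₂ * (eq_div_iff hD).1 hu' + σ x₁ * (eq_div_iff hD).1 hv' +
      (x₂ ^ 2 - β) * hnorm
  have htrF : x₁ + σ x₁ ∈ IntermediateField.adjoin k {u, v} := htr ▸ div_mem
    (sub_mem (add_mem (one_mem _) (mul_mem (haF _) (pow_mem hvF 2)))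
      (mul_mem (hbF _) (pow_mem huF 2))) hvF
  have hspan := IntermediateField.exists_eq_add_mul_of_adjoin_eq_top hF htrF
    (hnorm ▸ haF _) hgen (by
      rintro z (rfl | rfl)
      · exact ⟨0, zero_mem _, 1, one_mem _, by ring⟩
      · refine ⟨(1 - v * (x₁ + σ x₁)) / u,
          div_mem (sub_mem (one_mem _) (mul_mem hvF htrF)) huF, v / u, div_mem hvF huF, ?_⟩
        rw [hx₂_eq]
        ring)
  have hfix := IntermediateField.fixedField_zpowers_eq hF hxσ hspan
  refine ⟨hfix, {u, v}, ?_, hfix.symm⟩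
  have hx₁_alg : IsAlgebraic (IntermediateField.adjoin k {u, v}) x₁ := by
    obtain ⟨p, hp, q, hq, hpq⟩ := hspan (x₁ ^ 2)
    refine ⟨.X ^ 2 - .C ⟨q, hq⟩ * .X - .C ⟨p, hp⟩, Polynomial.Monic.ne_zero (by monicity!), ?_⟩
    simp only [map_sub, map_mul, map_pow, Polynomial.aeval_X, Polynomial.aeval_C,
      IntermediateField.algebraMap_apply]
    linear_combination hpq
  have : Algebra.IsAlgebraic (IntermediateField.adjoin k {u, v}) K := ⟨fun z ↦ by
    obtain ⟨p, hp, q, hq, rfl⟩ := hspan z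
    exact (isAlgebraic_algebraMap (⟨p, hp⟩ : IntermediateField.adjoin k {u, v})).add
      ((isAlgebraic_algebraMap (⟨q, hq⟩ : IntermediateField.adjoin k {u, v})).mul hx₁_alg)⟩
  exact hx.pair_of_isAlgebraic_adjoin.to_subtype_range' (Matrix.range_cons_cons_empty u v _)
end

section
/- Let k be any field, and let σ be the k-automorphism of the rational function field k(x₁,x₂,x₃) given by cyclic permutation x₁ ↦ x₂ ↦ x₃ ↦ x₁. Then the fixed field k(x₁,x₂,x₃)^⟨σ⟩ is purely transcendental over k (of transcendence degree 3). -/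
open IntermediateField.algebraAdjoinAdjoin in
theorem isAlgebraic_adjoin_of_isAlgebraic_intermediateField_adjoin
    {k K : Type*} [Field k] [Field K] [Algebra k K] (s : Set K)
    [Algebra.IsAlgebraic (IntermediateField.adjoin k s) K] :
    Algebra.IsAlgebraic (Algebra.adjoin k s) K :=
  (IsFractionRing.comap_isAlgebraic_iff (A := Algebra.adjoin k s)
    (K := IntermediateField.adjoin k s)).mpr inferInstance

/-- If `x` generates `K` up to an algebraic extension and is algebraically independent, then so is
any set of at most as many elements over which `K` is algebraic. -/
theorem AlgebraicIndependent.of_isAlgebraic_of_ncard_le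
    {k K ι : Type*} [Field k] [Field K] [Algebra k K] [Finite ι] {x : ι → K}
    (hx : AlgebraicIndependent k x) {s : Set K} (hs : s.Finite) (hcard : s.ncard ≤ Nat.card ι)
    [Algebra.IsAlgebraic (IntermediateField.adjoin k (Set.range x)) K]
    [Algebra.IsAlgebraic (IntermediateField.adjoin k s) K] :
    AlgebraicIndependent k ((↑) : s → K) := by
  have := isAlgebraic_adjoin_of_isAlgebraic_intermediateField_adjoin (k := k) s
  have hx' : IsTranscendenceBasis k x := hx.isTranscendenceBasis_iff_isAlgebraic.mpr
    (isAlgebraic_adjoin_of_isAlgebraic_intermediateField_adjoin _)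
  obtain ⟨t, hts, ht⟩ := exists_isTranscendenceBasis_subset (R := k) s
  have hc : Nat.card t = Nat.card ι := by
    simpa [Nat.card] using congrArg Cardinal.toNat (ht.lift_cardinalMk_eq hx')
  obtain rfl : t = s := Set.eq_of_subset_of_ncard_le hts (hcard.trans hc.ge) hs
  exact ht.1

theorem mem_fixedField_zpowers_iff {k K : Type*} [Field k] [Field K] [Algebra k K]
    {σ : K ≃ₐ[k] K} {y : K} :
    y ∈ IntermediateField.fixedField (Subgroup.zpowers σ) ↔ σ y = y := by
  rw [IntermediateField.mem_fixedField_iff]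
  refine ⟨fun h ↦ h σ (Subgroup.mem_zpowers σ), fun h f hf ↦ ?_⟩
  have hle : Subgroup.zpowers σ ≤ MulAction.stabilizer (K ≃ₐ[k] K) y :=
    Subgroup.zpowers_le.mpr h
  exact hle hf

namespace CyclicThree

section Formulas

variable {K : Type*} [Field K]

/-- The common denominator of Masuda's invariants. -/
def den (a b c : K) : K := a ^ 2 + b ^ 2 + c ^ 2 - a * b - b * c - c * a

/-- Masuda's invariant of the cyclic permutation of three variables; the second one is
`masuda c b a`. -/
def masuda (a b c : K) : K := (a * b ^ 2 + b * c ^ 2 + c * a ^ 2 - 3 * a * b * c) / den a b c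

/-- The set of generators of the field of cyclic invariants. -/
def generators (a b c : K) : Set K := {a + b + c, masuda a b c, masuda c b a}

theorem den_rotate (a b c : K) : den b c a = den a b c := by
  simp only [den]; ring

theorem den_reverse (a b c : K) : den c b a = den a b c := by
  simp only [den]; ring

theorem masuda_rotate (a b c : K) : masuda b c a = masuda a b c := by
  simp only [masuda, den_rotate]; congr 1; ring

theorem map_masuda {F : Type*} [FunLike F K K] [RingHomClass F K K] (f : F) (a b c : K) :
    f (masuda a b c) = masuda (f a) (f b) (f c) := by
  simp only [masuda, den, map_div₀, map_add, map_sub, map_mul, map_pow, map_ofNat]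

variable {a b c : K}

theorem masuda_mul_den (h : den a b c ≠ 0) :
    masuda a b c * den a b c = a * b ^ 2 + b * c ^ 2 + c * a ^ 2 - 3 * a * b * c :=
  div_mul_cancel₀ _ h

theorem masuda_reverse_mul_den (h : den a b c ≠ 0) :
    masuda c b a * den a b c = c * b ^ 2 + b * a ^ 2 + a * c ^ 2 - 3 * a * b * c := by
  rw [← den_reverse, masuda_mul_den (by rwa [den_reverse])]; ring

theorem esymm_two_eq (h : den a b c ≠ 0) :
    a * b + b * c + c * a = (a + b + c) * (masuda a b c + masuda c b a) -
      3 * (masuda a b c ^ 2 - masuda a b c * masuda c b a + masuda c b a ^ 2) := by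
  have hu := masuda_mul_den h
  have hv := masuda_reverse_mul_den h
  generalize masuda a b c = u at *
  generalize masuda c b a = v at *
  apply mul_right_cancel₀ (pow_ne_zero 2 h)
  have : ((a + b + c) * (u + v) - 3 * (u ^ 2 - u * v + v ^ 2)) * den a b c ^ 2 =
      (a + b + c) * (u * den a b c + v * den a b c) * den a b c -
        3 * ((u * den a b c) ^ 2 - (u * den a b c) * (v * den a b c) + (v * den a b c) ^ 2) := by
    ring
  rw [this, hu, hv]
  simp only [den]; ring

theorem esymm_three_eq (h : den a b c ≠ 0) :
    a * b * c = (a + b + c) * masuda a b c * masuda c b a -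
      (masuda a b c ^ 3 + masuda c b a ^ 3) := by
  have hu := masuda_mul_den h
  have hv := masuda_reverse_mul_den h
  generalize masuda a b c = u at *
  generalize masuda c b a = v at *
  apply mul_right_cancel₀ (pow_ne_zero 3 h)
  have : ((a + b + c) * u * v - (u ^ 3 + v ^ 3)) * den a b c ^ 3 =
      (a + b + c) * (u * den a b c) * (v * den a b c) * den a b c -
        ((u * den a b c) ^ 3 + (v * den a b c) ^ 3) := by
    ring
  rw [this, hu, hv]
  simp only [den]; ring

end Formulas

section Generators

variable {k K : Type*} [Field k] [Field K] [Algebra k K]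

theorem den_ne_zero {x : Fin 3 → K} (hx : AlgebraicIndependent k x) :
    den (x 0) (x 1) (x 2) ≠ 0 := by
  intro h
  let p : MvPolynomial (Fin 3) k :=
    .X 0 ^ 2 + .X 1 ^ 2 + .X 2 ^ 2 - .X 0 * .X 1 - .X 1 * .X 2 - .X 2 * .X 0
  have hp : p = 0 := hx.eq_zero_of_aeval_eq_zero p (by simpa [p, den] using h)
  simpa [p] using congrArg (MvPolynomial.eval ![1, 0, 0]) hp

variable {a b c : K} (L : IntermediateField k K)

theorem esymm_mem (hL : generators a b c ⊆ L) (h : den a b c ≠ 0) :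
    a + b + c ∈ L ∧ a * b + b * c + c * a ∈ L ∧ a * b * c ∈ L := by
  have hs : a + b + c ∈ L := hL (by simp [generators])
  have hu : masuda a b c ∈ L := hL (by simp [generators])
  have hv : masuda c b a ∈ L := hL (by simp [generators])
  refine ⟨hs, ?_, ?_⟩
  · rw [esymm_two_eq h]
    exact sub_mem (mul_mem hs (add_mem hu hv)) (mul_mem (ofNat_mem L 3)
      (add_mem (sub_mem (pow_mem hu 2) (mul_mem hu hv)) (pow_mem hv 2)))
  · rw [esymm_three_eq h]
    exact sub_mem (mul_mem (mul_mem hs hu) hv) (add_mem (pow_mem hu 3) (pow_mem hv 3))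

theorem mem_of_generators_subset (hL : generators a b c ⊆ L) (h : den a b c ≠ 0)
    (ha : a ∈ L) (hab : a ≠ b) (hac : a ≠ c) : b ∈ L ∧ c ∈ L := by
  obtain ⟨h₁, h₂, h₃⟩ := esymm_mem L hL h
  have hu : masuda a b c ∈ L := hL (by simp [generators])
  have hp : b + c ∈ L := by
    rw [show b + c = a + b + c - a by ring]; exact sub_mem h₁ ha
  have hq : b * c ∈ L := by
    rw [show b * c = a * b + b * c + c * a - a * (b + c) by ring]
    exact sub_mem h₂ (mul_mem ha hp)
  have hden : den a b c ∈ L := by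
    rw [show den a b c = (a + b + c) ^ 2 - 3 * (a * b + b * c + c * a) by simp only [den]; ring]
    exact sub_mem (pow_mem h₁ 2) (mul_mem (ofNat_mem L 3) h₂)
  have hb : b = (a ^ 2 * (b + c) + b * c * (b + c) - a * (b * c) - 3 * (a * b * c)
      - masuda a b c * den a b c) / (a ^ 2 - a * (b + c) + b * c) := by
    rw [masuda_mul_den h, eq_div_iff]
    · ring
    · rw [show a ^ 2 - a * (b + c) + b * c = (a - b) * (a - c) by ring]
      exact mul_ne_zero (sub_ne_zero.mpr hab) (sub_ne_zero.mpr hac)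
  have hbL : b ∈ L := by
    rw [hb]
    exact div_mem (sub_mem (sub_mem (sub_mem (add_mem (mul_mem (pow_mem ha 2) hp) (mul_mem hq hp))
      (mul_mem ha hq)) (mul_mem (ofNat_mem L 3) h₃)) (mul_mem hu hden))
      (add_mem (sub_mem (pow_mem ha 2) (mul_mem ha hp)) hq)
  refine ⟨hbL, ?_⟩
  rw [show c = b + c - b by ring]
  exact sub_mem hp hbL

open Polynomial in
theorem exists_monic_cubic (hL : generators a b c ⊆ L) (h : den a b c ≠ 0) :
    ∃ p : L[X], p.Monic ∧ p.natDegree = 3 ∧ aeval a p = 0 := by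
  obtain ⟨h₁, h₂, h₃⟩ := esymm_mem L hL h
  let q : L[X] := C ⟨_, neg_mem h₁⟩ * X ^ 2 + C ⟨_, h₂⟩ * X + C ⟨_, neg_mem h₃⟩
  have hq : q.degree < 3 := by
    refine degree_quadratic_le.trans_lt ?_
    norm_num
  refine ⟨X ^ 3 + q, monic_X_pow_add hq, ?_, ?_⟩
  · rw [natDegree_add_eq_left_of_degree_lt (by rwa [degree_X_pow]), natDegree_X_pow]
  · simp only [q, map_add, map_mul, map_pow, aeval_X, aeval_C, IntermediateField.algebraMap_apply]
    ring

open IntermediateField in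
theorem adjoin_simple_eq_top (hgen : adjoin k {a, b, c} = ⊤) (hL : generators a b c ⊆ L)
    (h : den a b c ≠ 0) (hab : a ≠ b) (hac : a ≠ c) : adjoin L {a} = ⊤ := by
  have ha : a ∈ (adjoin L {a}).restrictScalars k := mem_adjoin_simple_self L a
  have hL' : L ≤ (adjoin L {a}).restrictScalars k := fun y hy ↦
    (adjoin L {a}).algebraMap_mem ⟨y, hy⟩
  obtain ⟨hb, hc⟩ := mem_of_generators_subset _ (hL.trans hL') h ha hab hac
  have htop : (⊤ : IntermediateField k K) ≤ (adjoin L {a}).restrictScalars k := by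
    rw [← hgen, adjoin_le_iff]
    rintro y (rfl | rfl | rfl) <;> assumption
  exact eq_top_iff.mpr fun y _ ↦ htop (mem_top (x := y))

open IntermediateField in
theorem finiteDimensional_and_finrank_le_three (hgen : adjoin k {a, b, c} = ⊤)
    (hL : generators a b c ⊆ L) (h : den a b c ≠ 0) (hab : a ≠ b) (hac : a ≠ c) :
    FiniteDimensional L K ∧ Module.finrank L K ≤ 3 := by
  obtain ⟨p, hp, hdeg, hroot⟩ := exists_monic_cubic L hL h
  have ha_int : IsIntegral L a := ⟨p, hp, hroot⟩
  have htop := adjoin_simple_eq_top L hgen hL h hab hac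
  constructor
  · have := adjoin.finiteDimensional ha_int
    rw [htop] at this
    exact Module.Finite.equiv (topEquiv (F := L) (E := K)).toLinearEquiv
  · rw [← finrank_top', ← htop, adjoin.finrank ha_int, ← hdeg]
    exact Polynomial.natDegree_le_of_dvd (minpoly.dvd L a hroot) hp.ne_zero

end Generators

end CyclicThree

open CyclicThree in
/-- The fixed field of the cyclic permutation `x₁ ↦ x₂ ↦ x₃ ↦ x₁` of a rational
function field in three variables is purely transcendental over `k`. -/
theorem cyclic_three_fixed_field_rational
    (k K : Type*) [Field k] [Field K] [Algebra k K]
    (x : Fin 3 → K) (hx : AlgebraicIndependent k x)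
    (hgen : IntermediateField.adjoin k (Set.range x) = ⊤)
    (σ : K ≃ₐ[k] K) (hσ : ∀ i : Fin 3, σ (x i) = x (i + 1)) :
    IsRationalExtension k (IntermediateField.fixedField (Subgroup.zpowers σ)) := by
  let s := generators (x 0) (x 1) (x 2)
  have hden := den_ne_zero hx
  have hrange : Set.range x = {x 0, x 1, x 2} := by
    ext y; simp [Fin.exists_fin_succ, eq_comm]
  have hσ0 : σ (x 0) = x 1 := hσ 0
  have hσ1 : σ (x 1) = x 2 := hσ 1
  have hσ2 : σ (x 2) = x 0 := hσ 2
  obtain ⟨hfin, hrank⟩ := finiteDimensional_and_finrank_le_three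
    (IntermediateField.adjoin k s) (hrange ▸ hgen) (IntermediateField.subset_adjoin k s) hden
    (hx.injective.ne (by decide)) (hx.injective.ne (by decide))
  have hpow : σ ^ 3 = 1 := by
    have hle : IntermediateField.adjoin k (Set.range x) ≤
        IntermediateField.fixedField (Subgroup.zpowers (σ ^ 3)) := by
      rw [hrange, IntermediateField.adjoin_le_iff]
      rintro _ (rfl | rfl | rfl) <;>
        simp only [SetLike.mem_coe, mem_fixedField_zpowers_iff, pow_three, AlgEquiv.mul_apply,
          hσ0, hσ1, hσ2]
    ext y
    exact mem_fixedField_zpowers_iff.mp (hle (hgen ▸ IntermediateField.mem_top))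
  have hord : orderOf σ = 3 := by
    refine orderOf_eq_prime hpow fun h ↦ ?_
    rw [h] at hσ0
    exact absurd (hx.injective hσ0) (by decide)
  have hfixed : IntermediateField.adjoin k s ≤
      IntermediateField.fixedField (Subgroup.zpowers σ) := by
    rw [IntermediateField.adjoin_le_iff]
    rintro _ (rfl | rfl | rfl) <;> rw [SetLike.mem_coe, mem_fixedField_zpowers_iff]
    · rw [map_add, map_add, hσ0, hσ1, hσ2]; ring
    · rw [map_masuda, hσ0, hσ1, hσ2, masuda_rotate]
    · rw [map_masuda, hσ0, hσ1, hσ2, masuda_rotate, masuda_rotate]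
  have hcard : Module.finrank (IntermediateField.fixedField (Subgroup.zpowers σ)) K = 3 := by
    have : Finite (Subgroup.zpowers σ) := Nat.finite_of_card_ne_zero (by
      rw [Nat.card_zpowers, hord]; decide)
    have := Fintype.ofFinite (Subgroup.zpowers σ)
    rw [← hord, ← Nat.card_zpowers, Nat.card_eq_fintype_card]
    exact FixedPoints.finrank_eq_card (Subgroup.zpowers σ) K
  refine ⟨s, ?_, IntermediateField.eq_of_le_of_finrank_le' hfixed (hrank.trans hcard.ge)⟩
  have : Algebra.IsAlgebraic (IntermediateField.adjoin k (Set.range x)) K := by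
    rw [hgen]
    exact ⟨fun y ↦ isAlgebraic_algebraMap (⟨y, trivial⟩ : (⊤ : IntermediateField k K))⟩
  refine hx.of_isAlgebraic_of_ncard_le
    (((Set.finite_singleton _).insert _).insert _) ?_
  rw [Nat.card_fin]
  exact (Set.ncard_insert_le _ _).trans (Nat.succ_le_succ <|
    (Set.ncard_insert_le _ _).trans (Nat.succ_le_succ (Set.ncard_singleton _).le))
end

section
/- Let k be any field and let G be any subgroup of the symmetric group S₃, acting on the rational function field k(x₁,x₂,x₃) by permuting the variables: σ·xᵢ = x_{σ(i)}. Then the fixed field k(x₁,x₂,x₃)^G is purely transcendental over k. -/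
open Polynomial in
/-- If an intermediate field `L` of `K / k` contains the elementary symmetric functions of three
distinct generators of `K`, then `K` is a finite Galois extension of `L`. -/
theorem isGalois_of_esymm_mem {k K : Type*} [Field k] [Field K] [Algebra k K]
    {x : Fin 3 → K} (hx : Function.Injective x)
    (hgen : IntermediateField.adjoin k (Set.range x) = ⊤) (L : IntermediateField k K)
    (h₁ : x 0 + x 1 + x 2 ∈ L) (h₂ : x 0 * x 1 + x 1 * x 2 + x 2 * x 0 ∈ L)
    (h₃ : x 0 * x 1 * x 2 ∈ L) : IsGalois L K ∧ FiniteDimensional L K := by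
  let p : L[X] := X ^ 3 - C ⟨_, h₁⟩ * X ^ 2 + C ⟨_, h₂⟩ * X - C ⟨_, h₃⟩
  have hp : p.map (algebraMap L K) = ∏ i, (X - C (x i)) := by
    simp only [p, Polynomial.map_add, Polynomial.map_sub, Polynomial.map_mul, Polynomial.map_pow,
      map_X, map_C, IntermediateField.algebraMap_apply, Fin.prod_univ_three, map_add, map_mul]
    ring
  have hsep : p.Separable := by
    rw [← separable_map (algebraMap L K), hp]
    exact separable_prod_X_sub_C_iff.2 hx
  have hroots : Set.range x ⊆ p.rootSet K := by
    rintro _ ⟨i, rfl⟩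
    rw [mem_rootSet_of_ne hsep.ne_zero, aeval_def, ← eval_map, hp, eval_prod]
    exact Finset.prod_eq_zero (Finset.mem_univ i) (by simp)
  have hsplit : p.IsSplittingField L K := by
    rw [isSplittingField_iff_intermediateField]
    refine ⟨hp ▸ Splits.prod fun i _ => Splits.X_sub_C _, ?_⟩
    rw [← IntermediateField.restrictScalars_eq_top_iff (K := k), eq_top_iff, ← hgen,
      IntermediateField.adjoin_le_iff]
    exact hroots.trans (IntermediateField.subset_adjoin L _)
  exact ⟨IsGalois.of_separable_splitting_field hsep, IsSplittingField.finiteDimensional K p⟩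

/-- A criterion for the fixed field of a permutation action on three independent generators to be
generated by a given triple of invariants. -/
theorem isRationalExtension_fixedField_of_generators {k K : Type*} [Field k] [Field K] [Algebra k K]
    {x : Fin 3 → K} (hx : AlgebraicIndependent k x)
    (hgen : IntermediateField.adjoin k (Set.range x) = ⊤)
    {G : Subgroup (Equiv.Perm (Fin 3))}
    {ρ : G →* (K ≃ₐ[k] K)} (hρ : ∀ (g : G) (i : Fin 3), ρ g (x i) = x (g.1 i))
    (y : Fin 3 → K) (hy : ∀ g i, ρ g (y i) = y i)
    (h₁ : x 0 + x 1 + x 2 ∈ IntermediateField.adjoin k (Set.range y))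
    (h₂ : x 0 * x 1 + x 1 * x 2 + x 2 * x 0 ∈ IntermediateField.adjoin k (Set.range y))
    (h₃ : x 0 * x 1 * x 2 ∈ IntermediateField.adjoin k (Set.range y))
    (hG : ∀ (σ : K ≃ₐ[k] K) (π : Equiv.Perm (Fin 3)), (∀ i, σ (y i) = y i) →
      (∀ i, σ (x i) = x (π i)) → π ∈ G) :
    IsRationalExtension k (IntermediateField.fixedField ρ.range) := by
  set L := IntermediateField.adjoin k (Set.range y) with hL
  obtain ⟨hgal, hfin⟩ := isGalois_of_esymm_mem hx.injective hgen L h₁ h₂ h₃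
  have halg : Algebra.IsAlgebraic (Algebra.adjoin k (Set.range y)) K :=
    IntermediateField.isAlgebraic_adjoin_iff_top.1 (inferInstanceAs (Algebra.IsAlgebraic L K))
  have hbasis : IsTranscendenceBasis k y :=
    Algebra.IsAlgebraic.isTranscendenceBasis_of_lift_le_trdeg_of_finite k y
      hx.lift_cardinalMk_le_trdeg
  refine ⟨Set.range y, hbasis.1.to_subtype_range, le_antisymm ?_ fun z hz => ?_⟩
  · rw [IntermediateField.adjoin_le_iff]
    rintro _ ⟨i, rfl⟩
    rw [SetLike.mem_coe, IntermediateField.mem_fixedField_iff]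
    rintro _ ⟨g, rfl⟩
    exact hy g i
  · have hz' : z ∈ (⊥ : IntermediateField L K) := by
      refine (IsGalois.mem_bot_iff_fixed z).2 fun f => ?_
      let σ : K ≃ₐ[k] K := f.restrictScalars k
      have hσL (a : K) (ha : a ∈ L) : σ a = a := f.commutes ⟨a, ha⟩
      have hroot (i : Fin 3) : ∃ j, σ (x i) = x j := by
        have e₁ := hσL _ h₁
        have e₂ := hσL _ h₂
        have e₃ := hσL _ h₃
        have key (t : K) : (t - σ (x 0)) * (t - σ (x 1)) * (t - σ (x 2)) =
            (t - x 0) * (t - x 1) * (t - x 2) := by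
          simp only [map_add, map_mul] at e₁ e₂ e₃
          linear_combination - t ^ 2 * e₁ + t * e₂ - e₃
        have h0 : (σ (x i) - x 0) * (σ (x i) - x 1) * (σ (x i) - x 2) = 0 := by
          rw [← key]
          fin_cases i <;> simp
        simp only [mul_eq_zero, sub_eq_zero] at h0
        rcases h0 with (h | h) | h
        exacts [⟨0, h⟩, ⟨1, h⟩, ⟨2, h⟩]
      choose τ hτ using hroot
      have hτi : Function.Injective τ := fun i j hij =>
        hx.injective (σ.injective (by rw [hτ, hτ, hij]))
      let π : Equiv.Perm (Fin 3) := Equiv.ofBijective τ (Finite.injective_iff_bijective.1 hτi)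
      have hπ : π ∈ G := hG σ π
        (fun i => hσL _ (IntermediateField.subset_adjoin _ _ ⟨i, rfl⟩)) hτ
      have hσ : (σ : K →ₐ[k] K).comp (IntermediateField.val ⊤) =
          (ρ ⟨π, hπ⟩ : K →ₐ[k] K).comp (IntermediateField.val ⊤) := by
        refine IntermediateField.algHom_ext_of_eq_adjoin k hgen.symm ?_
        rintro _ ⟨i, rfl⟩
        exact (hτ i).trans (hρ ⟨π, hπ⟩ i).symm
      have hσz : σ z = ρ ⟨π, hπ⟩ z := DFunLike.congr_fun hσ ⟨z, trivial⟩
      exact hσz.trans ((IntermediateField.mem_fixedField_iff _ z).1 hz _ ⟨_, rfl⟩)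
    obtain ⟨w, rfl⟩ := IntermediateField.mem_bot.1 hz'
    exact w.2

theorem perm_fin_three_values (π : Equiv.Perm (Fin 3)) :
    (π 0 = 0 ∧ π 1 = 1 ∧ π 2 = 2) ∨ (π 0 = 1 ∧ π 1 = 2 ∧ π 2 = 0) ∨
    (π 0 = 2 ∧ π 1 = 0 ∧ π 2 = 1) ∨ (π 0 = 1 ∧ π 1 = 0 ∧ π 2 = 2) ∨
    (π 0 = 2 ∧ π 1 = 1 ∧ π 2 = 0) ∨ (π 0 = 0 ∧ π 1 = 2 ∧ π 2 = 1) := by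
  revert π
  decide

theorem perm_fin_three_even_or_odd (π : Equiv.Perm (Fin 3)) :
    (Equiv.Perm.sign π = 1 ∧ ((π 0 = 0 ∧ π 1 = 1 ∧ π 2 = 2) ∨ (π 0 = 1 ∧ π 1 = 2 ∧ π 2 = 0) ∨
      (π 0 = 2 ∧ π 1 = 0 ∧ π 2 = 1))) ∨
    (Equiv.Perm.sign π = -1 ∧ ((π 0 = 1 ∧ π 1 = 0 ∧ π 2 = 2) ∨ (π 0 = 2 ∧ π 1 = 1 ∧ π 2 = 0) ∨
      (π 0 = 0 ∧ π 1 = 2 ∧ π 2 = 1))) := by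
  revert π
  decide

/-- The subgroups of `S₃` are the trivial one, the point stabilizers, `A₃` and `S₃`. -/
theorem subgroup_perm_fin_three (G : Subgroup (Equiv.Perm (Fin 3))) :
    G = ⊥ ∨ (∃ l, ∀ g, g ∈ G ↔ g l = l) ∨ (∀ g, g ∈ G ↔ Equiv.Perm.sign g = 1) ∨ G = ⊤ := by
  by_cases hodd : ∃ s ∈ G, Equiv.Perm.sign s = -1
  · obtain ⟨s, hs, hsign⟩ := hodd
    obtain ⟨l, hl⟩ : ∃ l, s l = l := by clear hs; revert s; decide
    by_cases hfix : ∀ g ∈ G, g l = l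
    · refine .inr (.inl ⟨l, fun g => ⟨hfix g, fun hg => ?_⟩⟩)
      have : g = 1 ∨ g = s := by
        clear hs hfix
        revert s l g
        decide
      rcases this with rfl | rfl
      exacts [G.one_mem, hs]
    · push Not at hfix
      obtain ⟨g, hg, hgl⟩ := hfix
      refine .inr (.inr (.inr (eq_top_iff.2 fun h _ => ?_)))
      have : h = 1 ∨ h = s ∨ h = g ∨ h = s * g ∨ h = g * s ∨ h = s * g * s ∨
          h = g * g := by
        clear * - hsign hl hgl
        revert s l g h
        decide
      rcases this with rfl | rfl | rfl | rfl | rfl | rfl | rfl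
      exacts [G.one_mem, hs, hg, G.mul_mem hs hg, G.mul_mem hg hs,
        G.mul_mem (G.mul_mem hs hg) hs, G.mul_mem hg hg]
  · push Not at hodd
    have heven (g : Equiv.Perm (Fin 3)) (hg : g ∈ G) : Equiv.Perm.sign g = 1 :=
      (Int.units_eq_one_or _).resolve_right (hodd g hg)
    by_cases hbot : G = ⊥
    · exact .inl hbot
    · obtain ⟨c, hc, hc1⟩ := G.bot_or_exists_ne_one.resolve_left hbot
      have hsign := heven c hc
      refine .inr (.inr (.inl fun g => ⟨heven g, fun hg => ?_⟩))
      have : g = 1 ∨ g = c ∨ g = c * c := by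
        clear * - hsign hc1 hg
        revert c g
        decide
      rcases this with rfl | rfl | rfl
      exacts [G.one_mem, hc, G.mul_mem hc hc]

/-- With `D = e₁ ^ 2 - 3 * e₂`, the quotients `(a - 3 * e₃) / D` and
`(b - 3 * e₃) / D`, where `a` and `b` are the two cyclic sums, determine `e₂` and `e₃` given `e₁`. -/
theorem esymm_eq_of_cyclic_quotients {K : Type*} [Field K] {a b c D u v : K} (hD : D ≠ 0)
    (hD' : D = a ^ 2 + b ^ 2 + c ^ 2 - a * b - b * c - c * a)
    (hu : u = (a * b ^ 2 + b * c ^ 2 + c * a ^ 2 - 3 * (a * b * c)) / D)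
    (hv : v = (a ^ 2 * b + b ^ 2 * c + c ^ 2 * a - 3 * (a * b * c)) / D) :
    a * b + b * c + c * a = (a + b + c) * (u + v) - 3 * (u ^ 2 - u * v + v ^ 2) ∧
      a * b * c = (a + b + c) * u * v - (u ^ 3 + v ^ 3) := by
  subst hu hv
  constructor
  · field_simp
    rw [hD']
    ring
  · field_simp
    rw [hD']
    ring

theorem quadratic_form_ne_zero {k K : Type*} [Field k] [Field K] [Algebra k K] {x : Fin 3 → K}
    (hx : AlgebraicIndependent k x) :
    x 0 ^ 2 + x 1 ^ 2 + x 2 ^ 2 - x 0 * x 1 - x 1 * x 2 - x 2 * x 0 ≠ 0 := by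
  intro h
  let p : MvPolynomial (Fin 3) k := .X 0 ^ 2 + .X 1 ^ 2 + .X 2 ^ 2 - .X 0 * .X 1 - .X 1 * .X 2 -
    .X 2 * .X 0
  have hp : p = 0 := algebraicIndependent_iff.1 hx p (by simpa [p] using h)
  have := congrArg (MvPolynomial.eval ![1, 0, 0]) hp
  simp [p] at this

/-- For any subgroup `G` of `S_3` acting on the rational function field in 3 variables
over any field `k` by permuting the variables, the fixed field is purely
transcendental over `k`. -/
theorem fixed_field_S3_rational
    (k K : Type*) [Field k] [Field K] [Algebra k K]
    (x : Fin 3 → K) (hx : AlgebraicIndependent k x)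
    (hgen : IntermediateField.adjoin k (Set.range x) = ⊤)
    (G : Subgroup (Equiv.Perm (Fin 3)))
    (ρ : G →* (K ≃ₐ[k] K)) (hρ : ∀ (g : G) (i : Fin 3), ρ g (x i) = x (g.1 i)) :
    IsRationalExtension k (IntermediateField.fixedField ρ.range) := by
  have hsymm (σ : K ≃ₐ[k] K) (π : Equiv.Perm (Fin 3)) (hσ : ∀ i, σ (x i) = x (π i)) :
      σ (x 0 + x 1 + x 2) = x 0 + x 1 + x 2 ∧
      σ (x 0 * x 1 + x 1 * x 2 + x 2 * x 0) = x 0 * x 1 + x 1 * x 2 + x 2 * x 0 ∧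
      σ (x 0 * x 1 * x 2) = x 0 * x 1 * x 2 := by
    simp only [map_add, map_mul, hσ]
    rcases perm_fin_three_values π with h | h | h | h | h | h <;>
      refine ⟨?_, ?_, ?_⟩ <;> simp only [h] <;> ring
  rcases subgroup_perm_fin_three G with rfl | ⟨l, hl⟩ | hA | rfl
  · have hmem (i : Fin 3) : x i ∈ IntermediateField.adjoin k (Set.range x) := hgen ▸ trivial
    refine isRationalExtension_fixedField_of_generators hx hgen hρ x (fun g i => ?_)
      (add_mem (add_mem (hmem 0) (hmem 1)) (hmem 2))
      (add_mem (add_mem (mul_mem (hmem 0) (hmem 1)) (mul_mem (hmem 1) (hmem 2)))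
        (mul_mem (hmem 2) (hmem 0)))
      (mul_mem (mul_mem (hmem 0) (hmem 1)) (hmem 2)) (fun σ π hσ hπ => ?_)
    · rw [hρ, Subgroup.mem_bot.1 g.2, Equiv.Perm.one_apply]
    · exact Subgroup.mem_bot.2 (Equiv.ext fun i => hx.injective ((hπ i).symm.trans (hσ i)))
  · let y : Fin 3 → K := ![x l, x 0 + x 1 + x 2, x 0 * x 1 + x 1 * x 2 + x 2 * x 0]
    have hmem (i : Fin 3) : y i ∈ IntermediateField.adjoin k (Set.range y) :=
      IntermediateField.subset_adjoin _ _ ⟨i, rfl⟩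
    refine isRationalExtension_fixedField_of_generators hx hgen hρ y (fun g i => ?_)
      (hmem 1) (hmem 2) ?_ (fun σ π hσ hπ => (hl π).2 (hx.injective ((hπ l).symm.trans (hσ 0))))
    · have hs := hsymm (ρ g) g.1 (hρ g)
      fin_cases i
      exacts [(hρ g l).trans (congrArg x ((hl g.1).1 g.2)), hs.1, hs.2.1]
    · have he : x 0 * x 1 * x 2 = y 0 * (y 2 - y 0 * (y 1 - y 0)) := by
        simp only [y, Matrix.cons_val]
        fin_cases l <;> simp only [Fin.zero_eta, Fin.mk_one, Fin.reduceFinMk] <;> ring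
      rw [he]
      exact mul_mem (hmem 0) (sub_mem (hmem 2) (mul_mem (hmem 0) (sub_mem (hmem 1) (hmem 0))))
  · have hD := quadratic_form_ne_zero hx
    set D := x 0 ^ 2 + x 1 ^ 2 + x 2 ^ 2 - x 0 * x 1 - x 1 * x 2 - x 2 * x 0 with hD'
    set u := (x 0 * x 1 ^ 2 + x 1 * x 2 ^ 2 + x 2 * x 0 ^ 2 - 3 * (x 0 * x 1 * x 2)) / D with hu
    set v := (x 0 ^ 2 * x 1 + x 1 ^ 2 * x 2 + x 2 ^ 2 * x 0 - 3 * (x 0 * x 1 * x 2)) / D with hv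
    obtain ⟨he₂, he₃⟩ := esymm_eq_of_cyclic_quotients hD hD' hu hv
    let y : Fin 3 → K := ![x 0 + x 1 + x 2, u, v]
    have hmem (i : Fin 3) : y i ∈ IntermediateField.adjoin k (Set.range y) :=
      IntermediateField.subset_adjoin _ _ ⟨i, rfl⟩
    have hs : x 0 + x 1 + x 2 ∈ IntermediateField.adjoin k (Set.range y) := hmem 0
    have hu' : u ∈ IntermediateField.adjoin k (Set.range y) := hmem 1
    have hv' : v ∈ IntermediateField.adjoin k (Set.range y) := hmem 2
    refine isRationalExtension_fixedField_of_generators hx hgen hρ y (fun g i => ?_) hs ?_ ?_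
      (fun σ π hσ hπ => (hA π).2 ?_)
    · have hsign := (hA g.1).1 g.2
      have hg : ρ g u = u ∧ ρ g v = v := by
        simp only [hu, hv, hD', map_div₀, map_add, map_sub, map_mul, map_pow, map_ofNat, hρ]
        rcases perm_fin_three_even_or_odd g.1 with ⟨-, h | h | h⟩ | ⟨h, -⟩
        · simp only [h, and_self]
        · simp only [h]
          constructor <;> congr 1 <;> ring
        · simp only [h]
          constructor <;> congr 1 <;> ring
        · simp [hsign] at h
      fin_cases i
      exacts [(hsymm (ρ g) g.1 (hρ g)).1, hg.1, hg.2]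
    · rw [he₂]
      exact sub_mem (mul_mem hs (add_mem hu' hv')) (mul_mem (ofNat_mem _ 3)
        (add_mem (sub_mem (pow_mem hu' 2) (mul_mem hu' hv')) (pow_mem hv' 2)))
    · rw [he₃]
      exact sub_mem (mul_mem (mul_mem hs hu') hv') (add_mem (pow_mem hu' 3) (pow_mem hv' 3))
    · rcases perm_fin_three_even_or_odd π with ⟨h, -⟩ | ⟨-, h⟩
      · exact h
      · exfalso
        have huv : σ u = v := by
          simp only [hu, hv, hD', map_div₀, map_add, map_sub, map_mul, map_pow, map_ofNat, hπ]
          rcases h with h | h | h <;> simp only [h] <;> congr 1 <;> ring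
        have huv' : u = v := (hσ 1).symm.trans huv
        rw [hu, hv, div_left_inj' hD] at huv'
        have h0 : (x 0 - x 1) * (x 1 - x 2) * (x 2 - x 0) = 0 := by
          linear_combination huv'
        simp [sub_eq_zero, hx.injective.eq_iff] at h0
  · let y : Fin 3 → K :=
      ![x 0 + x 1 + x 2, x 0 * x 1 + x 1 * x 2 + x 2 * x 0, x 0 * x 1 * x 2]
    have hmem (i : Fin 3) : y i ∈ IntermediateField.adjoin k (Set.range y) :=
      IntermediateField.subset_adjoin _ _ ⟨i, rfl⟩
    refine isRationalExtension_fixedField_of_generators hx hgen hρ y (fun g i => ?_)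
      (hmem 0) (hmem 1) (hmem 2) (fun _ _ _ _ => trivial)
    have hs := hsymm (ρ g) g.1 (hρ g)
    fin_cases i
    exacts [hs.1, hs.2.1, hs.2.2]
end

section
/- Let k be any field and let G be any subgroup of the symmetric group S₄, acting on the rational function field k(x₁,x₂,x₃,x₄) by permuting the variables: σ·xᵢ = x_{σ(i)}. Then the fixed field k(x₁,x₂,x₃,x₄)^G is purely transcendental over k. -/
section FieldTheory

open IntermediateField Module

variable {k K : Type*} [Field k] [Field K] [Algebra k K]

/-- `K` is a finite extension of `k(s₀, s₁, s₂, s₃)` of degree at most `n`. -/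
def HasDegreeLE (k : Type*) {K : Type*} [Field k] [Field K] [Algebra k K]
    (s : Fin 4 → K) (n : ℕ) : Prop :=
  0 < finrank (adjoin k (Set.range s)) K ∧ finrank (adjoin k (Set.range s)) K ≤ n

theorem hasDegreeLE_one {x : Fin 4 → K} (hgen : adjoin k (Set.range x) = ⊤) :
    HasDegreeLE k x 1 := by
  rw [HasDegreeLE, hgen, IntermediateField.finrank_top]
  simp

/-- If `θ` is a root of a monic polynomial of degree `d` over `k(s)` and `k(s, θ)` contains all
`t i`, where `K` has degree at most `n` over `k(t)`, then `K` has degree at most `d * n`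
over `k(s)`. -/
theorem HasDegreeLE.of_monic {s t : Fin 4 → K} {n d : ℕ} (ht : HasDegreeLE k t n)
    (θ : K) (c : Fin d → K)
    (hc : ∀ M : IntermediateField k K, (∀ i, s i ∈ M) → ∀ i, c i ∈ M)
    (hθ : θ ^ d = ∑ i, c i * θ ^ (i : ℕ))
    (hst : ∀ M : IntermediateField k K, (∀ i, s i ∈ M) → θ ∈ M → ∀ i, t i ∈ M) :
    HasDegreeLE k s (d * n) := by
  set A := adjoin k (Set.range s) with hA
  replace hc : ∀ i, c i ∈ A := hc A fun i ↦ subset_adjoin _ _ ⟨i, rfl⟩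
  set B := adjoin k (Set.range s ∪ {θ}) with hB
  have hAB : A ≤ B := adjoin.mono _ _ _ Set.subset_union_left
  have hCB : adjoin k (Set.range t) ≤ B := by
    rw [adjoin_le_iff]
    rintro _ ⟨i, rfl⟩
    exact hst B (fun j ↦ subset_adjoin _ _ (Or.inl ⟨j, rfl⟩)) (subset_adjoin _ _ (Or.inr rfl)) i
  have h1 := relfinrank_mul_finrank_top hCB
  have h2 := relfinrank_mul_finrank_top hAB
  obtain ⟨h3, h4⟩ := ht
  rw [← h1] at h3 h4
  have hr : 0 < relfinrank (adjoin k (Set.range t)) B := Nat.pos_of_mul_pos_right h3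
  have hB0 : 0 < finrank B K := Nat.pos_of_mul_pos_left h3
  have hBn : finrank B K ≤ n := (Nat.le_mul_of_pos_left _ hr).trans h4
  have hext : extendScalars hAB = A⟮θ⟯ := by
    apply restrictScalars_injective k
    rw [extendScalars_restrictScalars, hA, adjoin_adjoin_left]
  let p : Polynomial A :=
    Polynomial.X ^ d - ∑ i : Fin d, Polynomial.C ⟨c i, hc i⟩ * Polynomial.X ^ (i : ℕ)
  have hdeg : (∑ i : Fin d, Polynomial.C (⟨c i, hc i⟩ : A) * Polynomial.X ^ (i : ℕ)).degree <
      (d : WithBot ℕ) := by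
    refine (Polynomial.degree_sum_le _ _).trans_lt ?_
    rw [Finset.sup_lt_iff (by exact WithBot.bot_lt_coe d)]
    intro i _
    exact (Polynomial.degree_C_mul_X_pow_le _ _).trans_lt (by exact_mod_cast i.2)
  have hp : p.Monic := Polynomial.monic_X_pow_sub hdeg
  have hpd : p.natDegree = d := by
    apply Polynomial.natDegree_eq_of_degree_eq_some
    rw [Polynomial.degree_sub_eq_left_of_degree_lt] <;> rw [Polynomial.degree_X_pow]
    exact hdeg
  have hroot : Polynomial.aeval θ p = 0 := by
    simp [p, hθ, IntermediateField.algebraMap_apply]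
  have h_int : IsIntegral A θ := ⟨p, hp, hroot⟩
  have hrel : relfinrank A B = finrank A A⟮θ⟯ := by
    rw [relfinrank_eq_finrank_of_le hAB, hext]
  rw [adjoin.finrank h_int] at hrel
  have hle : (minpoly A θ).natDegree ≤ d :=
    hpd ▸ Polynomial.natDegree_le_of_dvd (minpoly.dvd A θ hroot) hp.ne_zero
  unfold HasDegreeLE
  rw [← hA, ← h2, hrel]
  exact ⟨Nat.mul_pos (minpoly.natDegree_pos h_int) hB0, Nat.mul_le_mul hle hBn⟩

theorem HasDegreeLE.algebraicIndependent {s x : Fin 4 → K} {n : ℕ} (hs : HasDegreeLE k s n)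
    (hx : AlgebraicIndependent k x) : AlgebraicIndependent k s := by
  have : FiniteDimensional (adjoin k (Set.range s)) K := .of_finrank_pos hs.1
  have : Algebra.IsAlgebraic (Algebra.adjoin k (Set.range s)) K :=
    isAlgebraic_adjoin_iff_top.1 inferInstance
  refine (Algebra.IsAlgebraic.isTranscendenceBasis_of_lift_le_trdeg_of_finite k s ?_).1
  exact hx.lift_cardinalMk_le_trdeg

theorem isRationalExtension_fixedField {G : Type*} [Group G] [Finite G]
    (ρ : G →* (K ≃ₐ[k] K)) (hρ : Function.Injective ρ) {x s : Fin 4 → K} {n : ℕ}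
    (hx : AlgebraicIndependent k x) (hs : HasDegreeLE k s n) (hn : n ≤ Nat.card G)
    (hfix : ∀ g i, ρ g (s i) = s i) :
    IsRationalExtension k (fixedField ρ.range) := by
  refine ⟨Set.range s, (hs.algebraicIndependent hx).to_subtype_range, ?_⟩
  have hle : adjoin k (Set.range s) ≤ fixedField ρ.range := by
    rw [adjoin_le_iff]
    rintro _ ⟨i, rfl⟩
    simp [hfix]
  refine le_antisymm hle (relfinrank_eq_one_iff.1 ?_)
  have h := relfinrank_mul_finrank_top hle
  have hcard : finrank (fixedField ρ.range) K = Nat.card G := by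
    have : Finite ρ.range := Finite.of_equiv G (MonoidHom.ofInjective hρ).toEquiv
    have := Fintype.ofFinite ρ.range
    rw [Nat.card_congr (MonoidHom.ofInjective hρ).toEquiv, Nat.card_eq_fintype_card]
    exact FixedPoints.finrank_eq_card ρ.range K
  obtain ⟨h1, h2⟩ := hs
  rw [← h] at h1 h2
  rw [hcard] at h1 h2
  have h3 := Nat.pos_of_mul_pos_right h1
  have h4 : (0 : ℕ) < Nat.card G := Nat.card_pos
  nlinarith [h2.trans hn]

end FieldTheory

section Steps

variable {k K : Type*} [Field k] [Field K] [Algebra k K]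

theorem forall_vecCons_four_mem {M : IntermediateField k K} {a b c d : K} :
    (∀ i, ![a, b, c, d] i ∈ M) ↔ a ∈ M ∧ b ∈ M ∧ c ∈ M ∧ d ∈ M := by
  simp [Fin.forall_fin_succ]

variable {n : ℕ} {s₀ s₁ s₂ s₃ t₀ t₁ t₂ t₃ : K}

theorem HasDegreeLE.mono (ht : HasDegreeLE k ![t₀, t₁, t₂, t₃] n)
    (hst : ∀ M : IntermediateField k K, s₀ ∈ M → s₁ ∈ M → s₂ ∈ M → s₃ ∈ M →
      t₀ ∈ M ∧ t₁ ∈ M ∧ t₂ ∈ M ∧ t₃ ∈ M) :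
    HasDegreeLE k ![s₀, s₁, s₂, s₃] n := by
  rw [← one_mul n]
  refine ht.of_monic 0 ![0] (fun M _ ↦ ?_) (by simp) fun M hM _ ↦ ?_
  · simp
  · rw [forall_vecCons_four_mem] at hM ⊢
    exact hst M hM.1 hM.2.1 hM.2.2.1 hM.2.2.2

theorem HasDegreeLE.quadratic (ht : HasDegreeLE k ![t₀, t₁, t₂, t₃] n) (θ p q : K)
    (hθ : θ ^ 2 = p * θ + q)
    (hst : ∀ M : IntermediateField k K, s₀ ∈ M → s₁ ∈ M → s₂ ∈ M → s₃ ∈ M →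
      (p ∈ M ∧ q ∈ M) ∧ (θ ∈ M → t₀ ∈ M ∧ t₁ ∈ M ∧ t₂ ∈ M ∧ t₃ ∈ M)) :
    HasDegreeLE k ![s₀, s₁, s₂, s₃] (2 * n) := by
  refine ht.of_monic θ ![q, p] (fun M hM ↦ ?_) ?_ fun M hM ↦ ?_
  · rw [forall_vecCons_four_mem] at hM
    simpa [Fin.forall_fin_succ, and_comm] using (hst M hM.1 hM.2.1 hM.2.2.1 hM.2.2.2).1
  · simp [Fin.sum_univ_succ, hθ, add_comm]
  · rw [forall_vecCons_four_mem] at hM ⊢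
    exact (hst M hM.1 hM.2.1 hM.2.2.1 hM.2.2.2).2

theorem HasDegreeLE.cubic (ht : HasDegreeLE k ![t₀, t₁, t₂, t₃] n) (θ p q r : K)
    (hθ : θ ^ 3 = p * θ ^ 2 + q * θ + r)
    (hst : ∀ M : IntermediateField k K, s₀ ∈ M → s₁ ∈ M → s₂ ∈ M → s₃ ∈ M →
      (p ∈ M ∧ q ∈ M ∧ r ∈ M) ∧ (θ ∈ M → t₀ ∈ M ∧ t₁ ∈ M ∧ t₂ ∈ M ∧ t₃ ∈ M)) :
    HasDegreeLE k ![s₀, s₁, s₂, s₃] (3 * n) := by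
  refine ht.of_monic θ ![r, q, p] (fun M hM ↦ ?_) ?_ fun M hM ↦ ?_
  · rw [forall_vecCons_four_mem] at hM
    obtain ⟨⟨hp, hq, hr⟩, -⟩ := hst M hM.1 hM.2.1 hM.2.2.1 hM.2.2.2
    simp [Fin.forall_fin_succ, hp, hq, hr]
  · simp [Fin.sum_univ_succ, hθ]
    ring
  · rw [forall_vecCons_four_mem] at hM ⊢
    exact (hst M hM.1 hM.2.1 hM.2.2.1 hM.2.2.2).2

theorem HasDegreeLE.quartic (ht : HasDegreeLE k ![t₀, t₁, t₂, t₃] n) (θ p q r u : K)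
    (hθ : θ ^ 4 = p * θ ^ 3 + q * θ ^ 2 + r * θ + u)
    (hst : ∀ M : IntermediateField k K, s₀ ∈ M → s₁ ∈ M → s₂ ∈ M → s₃ ∈ M →
      (p ∈ M ∧ q ∈ M ∧ r ∈ M ∧ u ∈ M) ∧ (θ ∈ M → t₀ ∈ M ∧ t₁ ∈ M ∧ t₂ ∈ M ∧ t₃ ∈ M)) :
    HasDegreeLE k ![s₀, s₁, s₂, s₃] (4 * n) := by
  refine ht.of_monic θ ![u, r, q, p] (fun M hM ↦ ?_) ?_ fun M hM ↦ ?_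
  · rw [forall_vecCons_four_mem] at hM
    obtain ⟨⟨hp, hq, hr, hu⟩, -⟩ := hst M hM.1 hM.2.1 hM.2.2.1 hM.2.2.2
    simp [Fin.forall_fin_succ, hp, hq, hr, hu]
  · simp [Fin.sum_univ_succ, hθ]
    ring
  · rw [forall_vecCons_four_mem] at hM ⊢
    exact (hst M hM.1 hM.2.1 hM.2.2.1 hM.2.2.2).2

variable {a b c d : K}

/-- Symmetrising two of the four generators. -/
theorem HasDegreeLE.esymm_two (h : HasDegreeLE k ![a, b, c, d] n) :
    HasDegreeLE k ![a + b, a * b, c, d] (2 * n) := by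
  refine h.quadratic a (a + b) (-(a * b)) (by ring) fun M h₀ h₁ h₂ h₃ ↦
    ⟨⟨h₀, M.neg_mem h₁⟩, fun ha ↦ ⟨ha, ?_, h₂, h₃⟩⟩
  simpa using M.sub_mem h₀ ha

/-- Symmetrising three of the four generators. -/
theorem HasDegreeLE.esymm_three (h : HasDegreeLE k ![a, b, c, d] n) :
    HasDegreeLE k ![a + b + c, a * b + a * c + b * c, a * b * c, d] (3 * (2 * n)) := by
  refine h.esymm_two.cubic c (a + b + c) (-(a * b + a * c + b * c)) (a * b * c) (by ring)
    fun M h₀ h₁ h₂ h₃ ↦ ⟨⟨h₀, M.neg_mem h₁, h₂⟩, fun hc ↦ ?_⟩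
  have hab : a + b ∈ M := by simpa using M.sub_mem h₀ hc
  refine ⟨hab, ?_, hc, h₃⟩
  convert M.sub_mem h₁ (M.mul_mem hab hc) using 1
  ring

/-- Symmetrising all four generators. -/
theorem HasDegreeLE.esymm_four (h : HasDegreeLE k ![a, b, c, d] n) :
    HasDegreeLE k ![a + b + c + d, a * b + a * c + b * c + (a + b + c) * d,
      a * b * c + (a * b + a * c + b * c) * d, a * b * c * d] (4 * (3 * (2 * n))) := by
  refine h.esymm_three.quartic d (a + b + c + d) (-(a * b + a * c + b * c + (a + b + c) * d))
    (a * b * c + (a * b + a * c + b * c) * d) (-(a * b * c * d)) (by ring)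
    fun M h₀ h₁ h₂ h₃ ↦ ⟨⟨h₀, M.neg_mem h₁, h₂, M.neg_mem h₃⟩, fun hd ↦ ?_⟩
  have h₀' : a + b + c ∈ M := by simpa using M.sub_mem h₀ hd
  have h₁' : a * b + a * c + b * c ∈ M := by simpa using M.sub_mem h₁ (M.mul_mem h₀' hd)
  have h₂' : a * b * c ∈ M := by simpa using M.sub_mem h₂ (M.mul_mem h₁' hd)
  exact ⟨h₀', h₁', h₂', hd⟩

/-- Generators of the field of invariants of the involution `a ↔ b`, `c ↔ d`: the line through
`(a, c)` and `(b, d)` is invariant. -/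
theorem HasDegreeLE.double_swap (h : HasDegreeLE k ![a, b, c, d] n) (hab : a - b ≠ 0) :
    HasDegreeLE k ![a + b, a * b, c - (c - d) / (a - b) * a, (c - d) / (a - b)] (2 * n) := by
  refine h.quadratic a (a + b) (-(a * b)) (by ring) fun M h₀ h₁ h₂ h₃ ↦
    ⟨⟨h₀, M.neg_mem h₁⟩, fun ha ↦ ?_⟩
  have hb : b ∈ M := by simpa using M.sub_mem h₀ ha
  refine ⟨ha, hb, by simpa using M.add_mem h₂ (M.mul_mem h₃ ha), ?_⟩
  convert M.add_mem h₂ (M.mul_mem h₃ hb) using 1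
  field_simp
  ring

/-- Descent along the involution `m ↦ -m⁻¹`, `l ↦ u + l / m`, `u ↦ 2 * l + m * u`,
`v ↦ l ^ 2 + l * m * u + m ^ 2 * v`. -/
theorem HasDegreeLE.neg_inv_descent {u v l m : K} (h : HasDegreeLE k ![u, v, l, m] n) (hm : m ≠ 0)
    (hm' : m ^ 2 + 1 ≠ 0) :
    HasDegreeLE k ![m - 1 / m, u + (2 * l + m * u), l + (u + l / m),
      v + (l ^ 2 + l * m * u + m ^ 2 * v)] (2 * n) := by
  refine h.quadratic m (m - 1 / m) 1 (by field_simp; ring) fun M h₀ h₁ h₂ h₃ ↦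
    ⟨⟨h₀, M.one_mem⟩, fun hmM ↦ ?_⟩
  have hl : l ∈ M := by
    have key : l = ((1 + m) * (l + (u + l / m)) - (u + (2 * l + m * u))) / (m + 1 / m) := by
      have : m + 1 / m ≠ 0 := by
        rw [show m + 1 / m = (m ^ 2 + 1) / m by field_simp]
        exact div_ne_zero hm' hm
      rw [eq_div_iff this]
      field_simp
      ring
    rw [key]
    apply_rules [div_mem, sub_mem, mul_mem, add_mem, one_mem]
  have hu : u ∈ M := by
    have key : u = l + (u + l / m) - l * (1 + 1 / m) := by ring
    rw [key]
    apply_rules [div_mem, sub_mem, mul_mem, add_mem, one_mem]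
  have hv : v ∈ M := by
    have key : v = (v + (l ^ 2 + l * m * u + m ^ 2 * v) - l * l - l * m * u) / (m * m + 1) := by
      rw [eq_div_iff (by rwa [← sq])]
      ring
    rw [key]
    apply_rules [div_mem, sub_mem, mul_mem, add_mem, one_mem]
  exact ⟨hu, hv, hl, hmM⟩

/-- Generators of the field of invariants of the `3`-cycle `a ↦ b ↦ c ↦ a`. -/
theorem HasDegreeLE.three_cycle (h : HasDegreeLE k ![a, b, c, d] n) (hab : a - b ≠ 0)
    (hbc : b - c ≠ 0) (hca : c - a ≠ 0)
    (hD : (a - b) ^ 2 + (a - b) * (b - c) + (b - c) ^ 2 ≠ 0) :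
    HasDegreeLE k ![a + b + c, (a - b) / (b - c) + (b - c) / (c - a) + (c - a) / (a - b),
      (a - b) / (b - c) * b + (b - c) / (c - a) * c + (c - a) / (a - b) * a, d] (3 * n) := by
  obtain ⟨t, ht⟩ : ∃ t, t = (a - b) / (b - c) := ⟨_, rfl⟩
  have ha : a = b + t * (b - c) := by
    rw [ht]
    field_simp
    ring
  have ht0 : t ≠ 0 := by
    rw [ht]
    exact div_ne_zero hab hbc
  have ht1 : 1 + t ≠ 0 := by
    intro h1
    apply hca
    linear_combination -(b - c) * h1 - ha
  have ht2 : t ^ 2 + t + 1 ≠ 0 := by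
    intro h1
    apply hD
    rw [ha]
    linear_combination (b - c) ^ 2 * h1
  have e1 : (b - c) / (c - a) = -1 / (1 + t) := by
    rw [div_eq_div_iff hca ht1, ha]
    ring
  have e2 : (c - a) / (a - b) = -(1 + t) / t := by
    rw [div_eq_div_iff hab ht0, ha]
    ring
  rw [← ht, e1, e2]
  set T := t + -1 / (1 + t) + -(1 + t) / t with hT
  refine h.cubic t T (T + 3) 1 ?_ fun M h₀ h₁ h₂ h₃ ↦
    ⟨⟨h₁, M.add_mem h₁ (ofNat_mem M 3), M.one_mem⟩, fun htM ↦ ?_⟩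
  · rw [hT]
    field_simp
    ring
  have hdet : (2 + t) * (1 + t + -1 / (1 + t)) - (1 - t) * (t - (1 + t) * (1 + t) / t) ≠ 0 := by
    have : (2 + t) * (1 + t + -1 / (1 + t)) - (1 - t) * (t - (1 + t) * (1 + t) / t) =
        (t ^ 2 + t + 1) ^ 2 / (t * (1 + t)) := by
      field_simp
      ring
    rw [this]
    exact div_ne_zero (pow_ne_zero _ ht2) (mul_ne_zero ht0 ht1)
  have hb : b ∈ M := by
    have key : b = ((1 + t + -1 / (1 + t)) * (a + b + c) -
        (1 - t) * (t * b + -1 / (1 + t) * c + -(1 + t) / t * a)) /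
        ((2 + t) * (1 + t + -1 / (1 + t)) - (1 - t) * (t - (1 + t) * (1 + t) / t)) := by
      rw [eq_div_iff hdet, ha]
      field_simp
      ring
    rw [key]
    apply_rules [div_mem, sub_mem, mul_mem, add_mem, one_mem, neg_mem, ofNat_mem]
  have hc : c ∈ M := by
    have key : c = ((2 + t) * (t * b + -1 / (1 + t) * c + -(1 + t) / t * a) -
        (t - (1 + t) * (1 + t) / t) * (a + b + c)) /
        ((2 + t) * (1 + t + -1 / (1 + t)) - (1 - t) * (t - (1 + t) * (1 + t) / t)) := by
      rw [eq_div_iff hdet, ha]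
      field_simp
      ring
    rw [key]
    apply_rules [div_mem, sub_mem, mul_mem, add_mem, one_mem, neg_mem, ofNat_mem]
  refine ⟨?_, hb, hc, h₃⟩
  rw [ha]
  apply_rules [sub_mem, mul_mem, add_mem]

/-- The image of `∞` under the involution of the projective line exchanging `a ↔ b` and
`c ↔ d`. -/
def involutionCenter (a b c d : K) : K := (a * b - c * d) / (a + b - c - d)

/-- Generators of the field of invariants of the Klein four-group. -/
theorem HasDegreeLE.klein_four (h : HasDegreeLE k ![a, b, c, d] n) (h₁ : a + b - c - d ≠ 0)
    (h₂ : b + c - a - d ≠ 0) (h₃ : c + a - b - d ≠ 0) (had : d - a ≠ 0) (hbd : d - b ≠ 0)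
    (hcd : d - c ≠ 0) :
    HasDegreeLE k ![involutionCenter a b c d, involutionCenter b c a d, involutionCenter c a b d,
      a + b + c + d] (4 * n) := by
  have r₀ : (c - involutionCenter a b c d) * (d - involutionCenter a b c d) =
      (involutionCenter b c a d - involutionCenter a b c d) *
        (involutionCenter c a b d - involutionCenter a b c d) := by
    unfold involutionCenter
    field_simp
    ring
  have r₁ : (a - involutionCenter b c a d) * (d - involutionCenter b c a d) =
      (involutionCenter a b c d - involutionCenter b c a d) *
        (involutionCenter c a b d - involutionCenter b c a d) := by
    unfold involutionCenter
    field_simp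
    ring
  have r₂ : (b - involutionCenter c a b d) * (d - involutionCenter c a b d) =
      (involutionCenter a b c d - involutionCenter c a b d) *
        (involutionCenter b c a d - involutionCenter c a b d) := by
    unfold involutionCenter
    field_simp
    ring
  have hne₀ : d - involutionCenter a b c d ≠ 0 := by
    have : d - involutionCenter a b c d = -((d - a) * (d - b)) / (a + b - c - d) := by
      unfold involutionCenter
      field_simp
      ring
    rw [this]
    exact div_ne_zero (neg_ne_zero.2 (mul_ne_zero had hbd)) h₁
  have hne₁ : d - involutionCenter b c a d ≠ 0 := by
    have : d - involutionCenter b c a d = -((d - b) * (d - c)) / (b + c - a - d) := by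
      unfold involutionCenter
      field_simp
      ring
    rw [this]
    exact div_ne_zero (neg_ne_zero.2 (mul_ne_zero hbd hcd)) h₂
  have hne₂ : d - involutionCenter c a b d ≠ 0 := by
    have : d - involutionCenter c a b d = -((d - c) * (d - a)) / (c + a - b - d) := by
      unfold involutionCenter
      field_simp
      ring
    rw [this]
    exact div_ne_zero (neg_ne_zero.2 (mul_ne_zero hcd had)) h₃
  generalize involutionCenter a b c d = y₀ at *
  generalize involutionCenter b c a d = y₁ at *
  generalize involutionCenter c a b d = y₂ at *
  generalize hS : a + b + c + d = S
  refine h.quartic d S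
    (-(y₀ * y₁ + y₀ * y₂ + y₁ * y₂ + (S - (y₀ + y₁ + y₂)) * (y₀ + y₁ + y₂) +
      ((y₁ - y₀) * (y₂ - y₀) + (y₀ - y₁) * (y₂ - y₁) + (y₀ - y₂) * (y₁ - y₂))))
    (y₀ * y₁ * y₂ + (S - (y₀ + y₁ + y₂)) * (y₀ * y₁ + y₀ * y₂ + y₁ * y₂) +
      ((y₁ - y₀) * (y₂ - y₀) * (y₁ + y₂) + (y₀ - y₁) * (y₂ - y₁) * (y₀ + y₂) +
        (y₀ - y₂) * (y₁ - y₂) * (y₀ + y₁)))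
    (-((S - (y₀ + y₁ + y₂)) * (y₀ * y₁ * y₂) +
      ((y₁ - y₀) * (y₂ - y₀) * (y₁ * y₂) + (y₀ - y₁) * (y₂ - y₁) * (y₀ * y₂) +
        (y₀ - y₂) * (y₁ - y₂) * (y₀ * y₁))))
    ?_ fun M g₀ g₁ g₂ g₃ ↦ ⟨?_, fun hd ↦ ?_⟩
  · subst hS
    linear_combination -(d - y₁) * (d - y₂) * r₀ - (d - y₀) * (d - y₂) * r₁ -
      (d - y₀) * (d - y₁) * r₂
  · refine ⟨g₃, ?_, ?_, ?_⟩ <;>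
      (apply_rules [sub_mem, mul_mem, add_mem, neg_mem]
       try apply_rules [sub_mem, mul_mem, add_mem])
  · refine ⟨?_, ?_, ?_, hd⟩
    · rw [← sub_add_cancel a y₁, eq_div_of_mul_eq hne₁ r₁]
      apply_rules [div_mem, sub_mem, mul_mem, add_mem]
    · rw [← sub_add_cancel b y₂, eq_div_of_mul_eq hne₂ r₂]
      apply_rules [div_mem, sub_mem, mul_mem, add_mem]
    · rw [← sub_add_cancel c y₀, eq_div_of_mul_eq hne₀ r₀]
      apply_rules [div_mem, sub_mem, mul_mem, add_mem]

end Steps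

section Classification

open Equiv

/-- Products of sublists of a list of group elements. -/
def sublistProds {G : Type*} [Monoid G] : List G → List G
  | [] => [1]
  | p :: l => sublistProds l ++ (sublistProds l).map (p * ·)

theorem sublistProds_induction {G : Type*} [Monoid G] {l : List G} {P : G → Prop}
    (one : P 1) (mul : ∀ p ∈ l, ∀ g, P g → P (p * g)) : ∀ g ∈ sublistProds l, P g := by
  induction l with
  | nil => simpa [sublistProds] using one
  | cons p l ih =>
    have ih' := ih fun q hq ↦ mul q (List.mem_cons_of_mem p hq)
    intro g hg
    simp only [sublistProds, List.mem_append, List.mem_map] at hg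
    obtain hg | ⟨g, hg, rfl⟩ := hg
    · exact ih' g hg
    · exact mul p List.mem_cons_self g (ih' g hg)

/-- Polycyclic generating sequences of representatives of the conjugacy classes of subgroups
of `S₄`. -/
def polycyclicGens : Fin 11 → List (Perm (Fin 4)) :=
  let a := swap 0 1
  let b := swap 2 3
  let c := swap 0 1 * swap 1 2
  let v := swap 0 1 * swap 2 3
  let w := swap 0 2 * swap 1 3
  let f := finRotate 4
  ![[], [a], [v], [c, c], [v, w], [a, b], [f, f, f], [a, c, c], [a, b, w], [c, c, v, w],
    [a, c, c, v, w]]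

/-- For each conjugacy class of subgroups of `S₄`, enough larger classes to have a member between
`H` and `⟨H, g⟩` for every `H` in the class and every `g ∉ H`. -/
def overgroupClasses : Fin 11 → List (Fin 11) :=
  ![[3, 1, 6, 2], [3, 2], [6, 3, 5, 4], [4, 6, 7], [6, 9], [6], [8], [8], [9], [10], []]

/-- A permutation of `Fin 4` encoded by the base 4 digits of a natural number. -/
def permCode (g : Perm (Fin 4)) : ℕ :=
  g 0 + 4 * (g 1 + 4 * (g 2 + 4 * g 3))

theorem permCode_injective : Function.Injective permCode := by
  intro g h hgh
  unfold permCode at hgh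
  ext i
  fin_cases i <;> grind

/-- Composition of permutations on the level of codes. -/
def codeMul (m n : ℕ) : ℕ :=
  let digit (m i : ℕ) : ℕ := m / 4 ^ i % 4
  digit m (digit n 0) + 4 * (digit m (digit n 1) + 4 * (digit m (digit n 2) + 4 *
    digit m (digit n 3)))

theorem permCode_mul (g h : Perm (Fin 4)) :
    permCode (g * h) = codeMul (permCode g) (permCode h) := by
  revert g h
  decide +kernel

theorem mem_sublistProds_polycyclicGens_ten (g : Perm (Fin 4)) :
    g ∈ sublistProds (polycyclicGens 10) := by
  revert g
  decide +kernel

/-- Codes of the elements of the representative of a conjugacy class of subgroups. -/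
def subgroupCodes (i : Fin 11) : List ℕ := (sublistProds (polycyclicGens i)).map permCode

theorem all_subgroupCodes : ∀ i, ((subgroupCodes 10).all fun g ↦
    (subgroupCodes i).any (Nat.beq g) || (overgroupClasses i).any fun j ↦
      (subgroupCodes 10).any fun π ↦ (polycyclicGens j).all fun p ↦
        (subgroupCodes i).any fun h ↦ Nat.beq (codeMul π (permCode p)) (codeMul h π) ||
          (subgroupCodes i).any fun h' ↦
            Nat.beq (codeMul π (permCode p)) (codeMul h (codeMul g (codeMul h' π)))) = true := by
  decide +kernel

theorem mem_sublistProds_or_exists_larger (i : Fin 11) (g : Perm (Fin 4)) :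
    g ∈ sublistProds (polycyclicGens i) ∨
      ∃ j > i, ∃ π : Perm (Fin 4), ∀ p ∈ polycyclicGens j,
        ∃ h ∈ sublistProds (polycyclicGens i), ∃ h' ∈ sublistProds (polycyclicGens i),
          π * p * π⁻¹ = h ∨ π * p * π⁻¹ = h * g * h' := by
  have hcodes := List.all_eq_true.1 (all_subgroupCodes i) (permCode g)
    (List.mem_map_of_mem (mem_sublistProds_polycyclicGens_ten g))
  simp only [subgroupCodes, List.any_map, Bool.or_eq_true, List.any_eq_true, List.all_eq_true,
    Function.comp_apply, Nat.beq_eq, ← permCode_mul, permCode_injective.eq_iff] at hcodes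
  obtain ⟨h, hh, rfl⟩ | ⟨j, hj, π, -, hπ⟩ := hcodes
  · exact .inl hh
  · have hij : ∀ i, ∀ j ∈ overgroupClasses i, i < j := by decide
    refine .inr ⟨j, hij i j hj, π, fun p hp ↦ ?_⟩
    obtain ⟨h, hh, e | ⟨h', hh', e⟩⟩ := hπ p hp
    · exact ⟨h, hh, h, hh, .inl (by rw [e, mul_inv_cancel_right])⟩
    · exact ⟨h, hh, h', hh', .inr (by rw [e]; group)⟩

end Classification

section Subgroups

open Equiv

theorem sublistProds_subset {G : Type*} [Group G] {l : List G} {H : Subgroup G}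
    (hl : ∀ p ∈ l, p ∈ H) : ∀ g ∈ sublistProds l, g ∈ H :=
  sublistProds_induction H.one_mem fun p hp _ hg ↦ H.mul_mem (hl p hp) hg

theorem exists_conj_polycyclicGens (G : Subgroup (Perm (Fin 4))) :
    ∃ (i : Fin 11) (π : Perm (Fin 4)), (∀ p ∈ polycyclicGens i, π * p * π⁻¹ ∈ G) ∧
      ∀ g ∈ G, π⁻¹ * g * π ∈ sublistProds (polycyclicGens i) := by
  classical
  obtain ⟨i, ⟨π, hπ⟩, hmax⟩ := (Set.toFinite {i : Fin 11 | ∃ π : Perm (Fin 4),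
    ∀ p ∈ polycyclicGens i, π * p * π⁻¹ ∈ G}).exists_maximal ⟨0, 1, by simp [polycyclicGens]⟩
  refine ⟨i, π, hπ, fun g hg ↦ ?_⟩
  by_contra hgi
  obtain ⟨j, hij, τ, hτ⟩ := (mem_sublistProds_or_exists_larger i _).resolve_left hgi
  refine hij.not_ge (hmax ⟨π * τ, fun p hp ↦ ?_⟩ hij.le)
  let H := G.comap (MulAut.conj π).toMonoidHom
  have hH : ∀ q ∈ sublistProds (polycyclicGens i), q ∈ H := sublistProds_subset hπ
  have hgH : π⁻¹ * g * π ∈ H := by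
    simpa [H, mul_assoc] using hg
  suffices τ * p * τ⁻¹ ∈ H by simpa [H, mul_assoc] using this
  obtain ⟨h, hh, h', hh', e | e⟩ := hτ p hp
  · exact e ▸ hH h hh
  · exact e ▸ H.mul_mem (H.mul_mem (hH h hh) hgH) (hH h' hh')

theorem card_sublistProds_polycyclicGens (i : Fin 11) :
    (sublistProds (polycyclicGens i)).toFinset.card = ![1, 2, 2, 3, 4, 4, 4, 6, 8, 12, 24] i := by
  revert i
  decide +kernel

end Subgroups

section Invariants

variable {k K : Type*} [Field k] [Field K] [Algebra k K]

theorem AlgebraicIndependent.ne_zero_of_eval_ne_zero {x : Fin 4 → K} (hx : AlgebraicIndependent k x)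
    (p : MvPolynomial (Fin 4) k) (v : Fin 4 → k) (hv : MvPolynomial.eval v p ≠ 0) {y : K}
    (hy : MvPolynomial.aeval x p = y) : y ≠ 0 := by
  rintro rfl
  exact hv (by rw [(algebraicIndependent_iff.1 hx) p hy, map_zero])

/-- Generators of a field over which `K` has degree at most `n`, fixed by those automorphisms
that act on `x` through a permutation in `l`. -/
def HasInvariants (k : Type*) {K : Type*} [Field k] [Field K] [Algebra k K] (x : Fin 4 → K)
    (l : List (Equiv.Perm (Fin 4))) (n : ℕ) : Prop :=
  ∃ s : Fin 4 → K, HasDegreeLE k s n ∧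
    ∀ p ∈ l, ∀ γ : K ≃ₐ[k] K, (∀ j, γ (x j) = x (p j)) → ∀ i, γ (s i) = s i

theorem isRationalExtension_of_hasInvariants {x : Fin 4 → K} (hx : AlgebraicIndependent k x)
    {n : ℕ} (G : Subgroup (Equiv.Perm (Fin 4))) (ρ : G →* (K ≃ₐ[k] K))
    (hρ : ∀ (g : G) (i : Fin 4), ρ g (x i) = x (g.1 i)) (π : Equiv.Perm (Fin 4))
    (l : List (Equiv.Perm (Fin 4))) (hl : ∀ p ∈ l, π * p * π⁻¹ ∈ G)
    (hG : ∀ g ∈ G, π⁻¹ * g * π ∈ sublistProds l) (hn : (sublistProds l).toFinset.card = n)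
    (hs : HasInvariants k (x ∘ π) l n) :
    IsRationalExtension k (IntermediateField.fixedField ρ.range) := by
  classical
  obtain ⟨s, hs, hfix⟩ := hs
  let H := G.comap (MulAut.conj π).toMonoidHom
  have hlH : ∀ p ∈ l, p ∈ H := hl
  let φ : H →* (K ≃ₐ[k] K) := ρ.comp (((MulAut.conj π).toMonoidHom.comp H.subtype).codRestrict G
    fun h ↦ h.2)
  have hφ : ∀ p ∈ sublistProds l, ∃ h : p ∈ H, ∀ i, φ ⟨p, h⟩ (s i) = s i := by
    refine sublistProds_induction ⟨H.one_mem, fun i ↦ ?_⟩ ?_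
    · exact (congrArg (fun f : K ≃ₐ[k] K ↦ f (s i)) (map_one φ) :)
    · rintro p hp g ⟨hg, hgs⟩
      refine ⟨H.mul_mem (hlH p hp) hg, fun i ↦ ?_⟩
      have hmul : φ ⟨p * g, H.mul_mem (hlH p hp) hg⟩ = φ ⟨p, hlH p hp⟩ * φ ⟨g, hg⟩ :=
        map_mul φ ⟨p, hlH p hp⟩ ⟨g, hg⟩
      rw [hmul, AlgEquiv.mul_apply, hgs]
      refine hfix p hp _ (fun j ↦ ?_) i
      simp [φ, hρ]
  refine isRationalExtension_fixedField ρ (fun g g' h ↦ ?_) hx hs ?_ fun g i ↦ ?_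
  · ext i : 2
    exact hx.injective (by rw [← hρ, ← hρ, h])
  · rw [← hn, ← Set.ncard_coe_finset]
    refine (Set.ncard_le_ncard_of_injOn (MulAut.conj π) (t := G) (fun g hg ↦ ?_)
      (MulAut.conj π).injective.injOn).trans_eq (Nat.card_coe_set_eq _)
    exact (hφ g (by simpa using hg)).1
  · obtain ⟨h, hi⟩ := hφ _ (hG g g.2)
    have hg : ρ g = φ ⟨_, h⟩ := congrArg ρ (Subtype.ext (by simp [mul_assoc]))
    rw [hg, hi]

end Invariants

section Cases

open Equiv MvPolynomial

variable {k K : Type*} [Field k] [Field K] [Algebra k K] {x : Fin 4 → K}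

theorem hasDegreeLE_vec_one (hgen : IntermediateField.adjoin k (Set.range x) = ⊤) :
    HasDegreeLE k ![x 0, x 1, x 2, x 3] 1 := by
  convert hasDegreeLE_one hgen
  ext i
  fin_cases i <;> rfl

theorem forall_apply_iff {γ : K ≃ₐ[k] K} {p : Perm (Fin 4)} :
    (∀ j, γ (x j) = x (p j)) ↔
      γ (x 0) = x (p 0) ∧ γ (x 1) = x (p 1) ∧ γ (x 2) = x (p 2) ∧ γ (x 3) = x (p 3) := by
  simp [Fin.forall_fin_succ]

theorem forall_vecCons_four_fixed {γ : K ≃ₐ[k] K} {a b c d : K} :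
    (∀ i, γ (![a, b, c, d] i) = ![a, b, c, d] i) ↔ γ a = a ∧ γ b = b ∧ γ c = c ∧ γ d = d := by
  simp [Fin.forall_fin_succ]

theorem map_involutionCenter (γ : K ≃ₐ[k] K) (a b c d : K) :
    γ (involutionCenter a b c d) = involutionCenter (γ a) (γ b) (γ c) (γ d) := by
  simp [involutionCenter]

theorem involutionCenter_swap (a b c d : K) :
    involutionCenter c d a b = involutionCenter a b c d := by
  rw [involutionCenter, involutionCenter, ← neg_div_neg_eq]
  ring

theorem involutionCenter_swap_left (a b c d : K) :
    involutionCenter b a c d = involutionCenter a b c d := by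
  simp [involutionCenter, mul_comm, add_comm]

theorem involutionCenter_swap_right (a b c d : K) :
    involutionCenter a b d c = involutionCenter a b c d := by
  rw [involutionCenter, involutionCenter, mul_comm d c, sub_right_comm]

theorem involutionCenter_swap_both (a b c d : K) :
    involutionCenter b a d c = involutionCenter a b c d := by
  rw [involutionCenter_swap_left, involutionCenter_swap_right]

theorem involutionCenter_reverse (a b c d : K) :
    involutionCenter d c b a = involutionCenter a b c d := by
  rw [involutionCenter_swap, involutionCenter_swap_both]

theorem hasInvariants_one (hgen : IntermediateField.adjoin k (Set.range x) = ⊤) :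
    HasInvariants k x (polycyclicGens 0) 1 :=
  ⟨x, hasDegreeLE_one hgen, by simp [polycyclicGens]⟩

theorem hasInvariants_transposition (hgen : IntermediateField.adjoin k (Set.range x) = ⊤) :
    HasInvariants k x (polycyclicGens 1) 2 := by
  refine ⟨_, (hasDegreeLE_vec_one hgen).esymm_two, ?_⟩
  simp only [polycyclicGens, Matrix.cons_val, List.forall_mem_cons, List.not_mem_nil, false_imp_iff,
    implies_true, and_true, forall_apply_iff, forall_vecCons_four_fixed, map_add, map_mul]
  rintro γ ⟨h₀ : _ = x 1, h₁ : _ = x 0, h₂ : _ = x 2, h₃ : _ = x 3⟩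
  rw [h₀, h₁, h₂, h₃]
  exact ⟨by ring, by ring, rfl, rfl⟩

theorem hasInvariants_doubleTransposition (hx : AlgebraicIndependent k x)
    (hgen : IntermediateField.adjoin k (Set.range x) = ⊤) :
    HasInvariants k x (polycyclicGens 2) 2 := by
  have h01 : x 0 - x 1 ≠ 0 :=
    hx.ne_zero_of_eval_ne_zero (X 0 - X 1) ![1, 0, 0, 0] (by simp) (by simp)
  have h10 : x 1 - x 0 ≠ 0 := neg_sub (x 0) (x 1) ▸ neg_ne_zero.2 h01
  refine ⟨_, (hasDegreeLE_vec_one hgen).double_swap h01, ?_⟩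
  simp only [polycyclicGens, Matrix.cons_val, List.forall_mem_cons, List.not_mem_nil, false_imp_iff,
    implies_true, and_true, forall_apply_iff, forall_vecCons_four_fixed, map_add, map_mul, map_sub,
    map_div₀]
  rintro γ ⟨h₀ : _ = x 1, h₁ : _ = x 0, h₂ : _ = x 3, h₃ : _ = x 2⟩
  rw [h₀, h₁, h₂, h₃]
  exact ⟨by ring, by ring, by field_simp; ring, by field_simp; ring⟩

theorem hasInvariants_cyclicThree (hx : AlgebraicIndependent k x)
    (hgen : IntermediateField.adjoin k (Set.range x) = ⊤) :
    HasInvariants k x (polycyclicGens 3) 3 := by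
  have h01 : x 0 - x 1 ≠ 0 :=
    hx.ne_zero_of_eval_ne_zero (X 0 - X 1) ![1, 0, 0, 0] (by simp) (by simp)
  have h12 : x 1 - x 2 ≠ 0 :=
    hx.ne_zero_of_eval_ne_zero (X 1 - X 2) ![0, 1, 0, 0] (by simp) (by simp)
  have h20 : x 2 - x 0 ≠ 0 :=
    hx.ne_zero_of_eval_ne_zero (X 2 - X 0) ![0, 0, 1, 0] (by simp) (by simp)
  have hD : (x 0 - x 1) ^ 2 + (x 0 - x 1) * (x 1 - x 2) + (x 1 - x 2) ^ 2 ≠ 0 :=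
    hx.ne_zero_of_eval_ne_zero
      ((X 0 - X 1) ^ 2 + (X 0 - X 1) * (X 1 - X 2) + (X 1 - X 2) ^ 2) ![1, 0, 0, 0]
      (by simp) (by simp)
  refine ⟨_, (hasDegreeLE_vec_one hgen).three_cycle h01 h12 h20 hD, ?_⟩
  simp only [polycyclicGens, Matrix.cons_val, List.forall_mem_cons, List.not_mem_nil, false_imp_iff,
    implies_true, and_true, and_self, forall_apply_iff, forall_vecCons_four_fixed, map_add, map_mul,
    map_sub, map_div₀]
  rintro γ ⟨h₀ : _ = x 1, h₁ : _ = x 2, h₂ : _ = x 0, h₃ : _ = x 3⟩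
  rw [h₀, h₁, h₂, h₃]
  exact ⟨by ring, by ring, by ring, rfl⟩

theorem hasDegreeLE_klein_four (hx : AlgebraicIndependent k x)
    (hgen : IntermediateField.adjoin k (Set.range x) = ⊤) :
    HasDegreeLE k ![involutionCenter (x 0) (x 1) (x 2) (x 3),
      involutionCenter (x 1) (x 2) (x 0) (x 3), involutionCenter (x 2) (x 0) (x 1) (x 3),
      x 0 + x 1 + x 2 + x 3] 4 := by
  refine (hasDegreeLE_vec_one hgen).klein_four ?_ ?_ ?_ ?_ ?_ ?_
  · exact hx.ne_zero_of_eval_ne_zero (X 0 + X 1 - X 2 - X 3) ![1, 0, 0, 0] (by simp) (by simp)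
  · exact hx.ne_zero_of_eval_ne_zero (X 1 + X 2 - X 0 - X 3) ![0, 1, 0, 0] (by simp) (by simp)
  · exact hx.ne_zero_of_eval_ne_zero (X 2 + X 0 - X 1 - X 3) ![0, 0, 1, 0] (by simp) (by simp)
  · exact hx.ne_zero_of_eval_ne_zero (X 3 - X 0) ![0, 0, 0, 1] (by simp) (by simp)
  · exact hx.ne_zero_of_eval_ne_zero (X 3 - X 1) ![0, 0, 0, 1] (by simp) (by simp)
  · exact hx.ne_zero_of_eval_ne_zero (X 3 - X 2) ![0, 0, 0, 1] (by simp) (by simp)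

theorem hasInvariants_kleinFour (hx : AlgebraicIndependent k x)
    (hgen : IntermediateField.adjoin k (Set.range x) = ⊤) :
    HasInvariants k x (polycyclicGens 4) 4 := by
  refine ⟨_, hasDegreeLE_klein_four hx hgen, ?_⟩
  simp only [polycyclicGens, Matrix.cons_val, List.forall_mem_cons, List.not_mem_nil, false_imp_iff,
    implies_true, and_true, forall_apply_iff, forall_vecCons_four_fixed, map_add,
    map_involutionCenter]
  constructor
  · rintro γ ⟨h₀ : _ = x 1, h₁ : _ = x 0, h₂ : _ = x 3, h₃ : _ = x 2⟩
    rw [h₀, h₁, h₂, h₃]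
    exact ⟨involutionCenter_swap_both .., involutionCenter_swap .., involutionCenter_reverse ..,
      by ring⟩
  · rintro γ ⟨h₀ : _ = x 2, h₁ : _ = x 3, h₂ : _ = x 0, h₃ : _ = x 1⟩
    rw [h₀, h₁, h₂, h₃]
    exact ⟨involutionCenter_swap .., involutionCenter_reverse .., involutionCenter_swap_both ..,
      by ring⟩

theorem hasDegreeLE_esymm_two_two (hgen : IntermediateField.adjoin k (Set.range x) = ⊤) :
    HasDegreeLE k ![x 0 + x 1, x 2 + x 3, x 0 * x 1, x 2 * x 3] 4 := by
  have h := (hasDegreeLE_vec_one hgen).esymm_two.mono (s₀ := x 2) (s₁ := x 3) (s₂ := x 0 + x 1)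
    (s₃ := x 0 * x 1) (fun M h₀ h₁ h₂ h₃ ↦ ⟨h₂, h₃, h₀, h₁⟩)
  exact h.esymm_two.mono fun M h₀ h₁ h₂ h₃ ↦ ⟨h₁, h₃, h₀, h₂⟩

theorem hasInvariants_twoTranspositions (hgen : IntermediateField.adjoin k (Set.range x) = ⊤) :
    HasInvariants k x (polycyclicGens 5) 4 := by
  refine ⟨_, hasDegreeLE_esymm_two_two hgen, ?_⟩
  simp only [polycyclicGens, Matrix.cons_val, List.forall_mem_cons, List.not_mem_nil, false_imp_iff,
    implies_true, and_true, forall_apply_iff, forall_vecCons_four_fixed, map_add, map_mul]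
  constructor
  · rintro γ ⟨h₀ : _ = x 1, h₁ : _ = x 0, h₂ : _ = x 2, h₃ : _ = x 3⟩
    rw [h₀, h₁, h₂, h₃]
    exact ⟨by ring, by ring, by ring, by ring⟩
  · rintro γ ⟨h₀ : _ = x 0, h₁ : _ = x 1, h₂ : _ = x 3, h₃ : _ = x 2⟩
    rw [h₀, h₁, h₂, h₃]
    exact ⟨by ring, by ring, by ring, by ring⟩

theorem hasInvariants_cyclicFour (hx : AlgebraicIndependent k x)
    (hgen : IntermediateField.adjoin k (Set.range x) = ⊤) :
    HasInvariants k x (polycyclicGens 6) 4 := by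
  have h02 : x 0 - x 2 ≠ 0 :=
    hx.ne_zero_of_eval_ne_zero (X 0 - X 2) ![1, 0, 0, 0] (by simp) (by simp)
  have h13 : x 1 - x 3 ≠ 0 :=
    hx.ne_zero_of_eval_ne_zero (X 1 - X 3) ![0, 1, 0, 0] (by simp) (by simp)
  have h20 : x 2 - x 0 ≠ 0 := neg_sub (x 0) (x 2) ▸ neg_ne_zero.2 h02
  have hD : (x 1 - x 3) ^ 2 + (x 0 - x 2) ^ 2 ≠ 0 :=
    hx.ne_zero_of_eval_ne_zero ((X 1 - X 3) ^ 2 + (X 0 - X 2) ^ 2) ![1, 0, 0, 0] (by simp) (by simp)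
  have hD' : ((x 1 - x 3) / (x 0 - x 2)) ^ 2 + 1 ≠ 0 := by
    rw [div_pow, div_add_one (pow_ne_zero 2 h02)]
    exact div_ne_zero hD (pow_ne_zero 2 h02)
  have h := (hasDegreeLE_vec_one hgen).mono (s₀ := x 0) (s₁ := x 2) (s₂ := x 1) (s₃ := x 3)
    fun M h₀ h₁ h₂ h₃ ↦ ⟨h₀, h₂, h₁, h₃⟩
  refine ⟨_, (h.double_swap h02).neg_inv_descent (div_ne_zero h13 h02) hD', ?_⟩
  simp only [polycyclicGens, Matrix.cons_val, List.forall_mem_cons, List.not_mem_nil, false_imp_iff,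
    implies_true, and_true, and_self, forall_apply_iff, forall_vecCons_four_fixed, map_add, map_mul,
    map_sub, map_div₀, map_one, map_pow, map_ofNat]
  rintro γ ⟨h₀ : _ = x 1, h₁ : _ = x 2, h₂ : _ = x 3, h₃ : _ = x 0⟩
  rw [h₀, h₁, h₂, h₃]
  exact ⟨by field_simp; ring, by field_simp; ring, by field_simp; ring, by field_simp; ring⟩

theorem hasInvariants_symmetricThree (hgen : IntermediateField.adjoin k (Set.range x) = ⊤) :
    HasInvariants k x (polycyclicGens 7) 6 := by
  refine ⟨_, (hasDegreeLE_vec_one hgen).esymm_three, ?_⟩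
  simp only [polycyclicGens, Matrix.cons_val, List.forall_mem_cons, List.not_mem_nil, false_imp_iff,
    implies_true, and_true, and_self, forall_apply_iff, forall_vecCons_four_fixed, map_add, map_mul]
  constructor
  · rintro γ ⟨h₀ : _ = x 1, h₁ : _ = x 0, h₂ : _ = x 2, h₃ : _ = x 3⟩
    rw [h₀, h₁, h₂, h₃]
    exact ⟨by ring, by ring, by ring, rfl⟩
  · rintro γ ⟨h₀ : _ = x 1, h₁ : _ = x 2, h₂ : _ = x 0, h₃ : _ = x 3⟩
    rw [h₀, h₁, h₂, h₃]
    exact ⟨by ring, by ring, by ring, rfl⟩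

theorem hasInvariants_dihedral (hx : AlgebraicIndependent k x)
    (hgen : IntermediateField.adjoin k (Set.range x) = ⊤) :
    HasInvariants k x (polycyclicGens 8) 8 := by
  have h : x 0 + x 1 - (x 2 + x 3) ≠ 0 :=
    hx.ne_zero_of_eval_ne_zero (X 0 + X 1 - (X 2 + X 3)) ![1, 0, 0, 0] (by simp) (by simp)
  have h' : x 2 + x 3 - (x 0 + x 1) ≠ 0 := neg_sub (x 0 + x 1) (x 2 + x 3) ▸ neg_ne_zero.2 h
  refine ⟨_, (hasDegreeLE_esymm_two_two hgen).double_swap h, ?_⟩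
  simp only [polycyclicGens, Matrix.cons_val, List.forall_mem_cons, List.not_mem_nil, false_imp_iff,
    implies_true, and_true, forall_apply_iff, forall_vecCons_four_fixed, map_add, map_mul, map_sub,
    map_div₀]
  refine ⟨?_, ?_, ?_⟩
  · rintro γ ⟨h₀ : _ = x 1, h₁ : _ = x 0, h₂ : _ = x 2, h₃ : _ = x 3⟩
    rw [h₀, h₁, h₂, h₃]
    exact ⟨by ring, by ring, by ring, by ring⟩
  · rintro γ ⟨h₀ : _ = x 0, h₁ : _ = x 1, h₂ : _ = x 3, h₃ : _ = x 2⟩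
    rw [h₀, h₁, h₂, h₃]
    exact ⟨by ring, by ring, by ring, by ring⟩
  · rintro γ ⟨h₀ : _ = x 2, h₁ : _ = x 3, h₂ : _ = x 0, h₃ : _ = x 1⟩
    rw [h₀, h₁, h₂, h₃]
    exact ⟨by ring, by ring, by field_simp; ring, by field_simp; ring⟩

theorem hasInvariants_alternating (hx : AlgebraicIndependent k x)
    (hgen : IntermediateField.adjoin k (Set.range x) = ⊤) :
    HasInvariants k x (polycyclicGens 9) 12 := by
  have h := hasDegreeLE_klein_four hx hgen
  have hy := h.algebraicIndependent hx
  refine ⟨_, h.three_cycle ?_ ?_ ?_ ?_, ?_⟩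
  · exact hy.ne_zero_of_eval_ne_zero (X 0 - X 1) ![1, 0, 0, 0] (by simp) (by simp)
  · exact hy.ne_zero_of_eval_ne_zero (X 1 - X 2) ![0, 1, 0, 0] (by simp) (by simp)
  · exact hy.ne_zero_of_eval_ne_zero (X 2 - X 0) ![0, 0, 1, 0] (by simp) (by simp)
  · exact hy.ne_zero_of_eval_ne_zero
      ((X 0 - X 1) ^ 2 + (X 0 - X 1) * (X 1 - X 2) + (X 1 - X 2) ^ 2) ![1, 0, 0, 0]
      (by simp) (by simp)
  simp only [polycyclicGens, Matrix.cons_val, List.forall_mem_cons, List.not_mem_nil, false_imp_iff,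
    implies_true, and_true, and_self_left, forall_apply_iff, forall_vecCons_four_fixed, map_add,
    map_mul, map_sub, map_div₀, map_involutionCenter]
  refine ⟨?_, ?_, ?_⟩
  · rintro γ ⟨h₀ : _ = x 1, h₁ : _ = x 2, h₂ : _ = x 0, h₃ : _ = x 3⟩
    rw [h₀, h₁, h₂, h₃]
    exact ⟨by ring, by ring, by ring, by ring⟩
  · rintro γ ⟨h₀ : _ = x 1, h₁ : _ = x 0, h₂ : _ = x 3, h₃ : _ = x 2⟩
    rw [h₀, h₁, h₂, h₃, involutionCenter_swap_both (x 0) (x 1) (x 2) (x 3),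
      involutionCenter_swap (x 1) (x 2) (x 0) (x 3),
      involutionCenter_reverse (x 2) (x 0) (x 1) (x 3)]
    exact ⟨rfl, rfl, rfl, by ring⟩
  · rintro γ ⟨h₀ : _ = x 2, h₁ : _ = x 3, h₂ : _ = x 0, h₃ : _ = x 1⟩
    rw [h₀, h₁, h₂, h₃, involutionCenter_swap (x 0) (x 1) (x 2) (x 3),
      involutionCenter_reverse (x 1) (x 2) (x 0) (x 3),
      involutionCenter_swap_both (x 2) (x 0) (x 1) (x 3)]
    exact ⟨rfl, rfl, rfl, by ring⟩

theorem hasInvariants_symmetricFour (hgen : IntermediateField.adjoin k (Set.range x) = ⊤) :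
    HasInvariants k x (polycyclicGens 10) 24 := by
  refine ⟨_, (hasDegreeLE_vec_one hgen).esymm_four, ?_⟩
  simp only [polycyclicGens, Matrix.cons_val, List.forall_mem_cons, List.not_mem_nil, false_imp_iff,
    implies_true, and_true, and_self_left, forall_apply_iff, forall_vecCons_four_fixed, map_add,
    map_mul]
  refine ⟨?_, ?_, ?_, ?_⟩
  · rintro γ ⟨h₀ : _ = x 1, h₁ : _ = x 0, h₂ : _ = x 2, h₃ : _ = x 3⟩
    rw [h₀, h₁, h₂, h₃]
    exact ⟨by ring, by ring, by ring, by ring⟩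
  · rintro γ ⟨h₀ : _ = x 1, h₁ : _ = x 2, h₂ : _ = x 0, h₃ : _ = x 3⟩
    rw [h₀, h₁, h₂, h₃]
    exact ⟨by ring, by ring, by ring, by ring⟩
  · rintro γ ⟨h₀ : _ = x 1, h₁ : _ = x 0, h₂ : _ = x 3, h₃ : _ = x 2⟩
    rw [h₀, h₁, h₂, h₃]
    exact ⟨by ring, by ring, by ring, by ring⟩
  · rintro γ ⟨h₀ : _ = x 2, h₁ : _ = x 3, h₂ : _ = x 0, h₃ : _ = x 1⟩
    rw [h₀, h₁, h₂, h₃]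
    exact ⟨by ring, by ring, by ring, by ring⟩

end Cases

theorem hasInvariants_polycyclicGens {k K : Type*} [Field k] [Field K] [Algebra k K]
    {x : Fin 4 → K} (hx : AlgebraicIndependent k x)
    (hgen : IntermediateField.adjoin k (Set.range x) = ⊤) (i : Fin 11) :
    HasInvariants k x (polycyclicGens i) (![1, 2, 2, 3, 4, 4, 4, 6, 8, 12, 24] i) := by
  fin_cases i
  · exact hasInvariants_one hgen
  · exact hasInvariants_transposition hgen
  · exact hasInvariants_doubleTransposition hx hgen
  · exact hasInvariants_cyclicThree hx hgen
  · exact hasInvariants_kleinFour hx hgen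
  · exact hasInvariants_twoTranspositions hgen
  · exact hasInvariants_cyclicFour hx hgen
  · exact hasInvariants_symmetricThree hgen
  · exact hasInvariants_dihedral hx hgen
  · exact hasInvariants_alternating hx hgen
  · exact hasInvariants_symmetricFour hgen

/-- For any subgroup `G` of `S_4` acting on the rational function field in 4 variables
over any field `k` by permuting the variables, the fixed field is purely
transcendental over `k`. -/
theorem fixed_field_S4_rational
    (k K : Type*) [Field k] [Field K] [Algebra k K]
    (x : Fin 4 → K) (hx : AlgebraicIndependent k x)
    (hgen : IntermediateField.adjoin k (Set.range x) = ⊤)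
    (G : Subgroup (Equiv.Perm (Fin 4)))
    (ρ : G →* (K ≃ₐ[k] K)) (hρ : ∀ (g : G) (i : Fin 4), ρ g (x i) = x (g.1 i)) :
    IsRationalExtension k (IntermediateField.fixedField ρ.range) := by
  obtain ⟨i, π, hG, hG'⟩ := exists_conj_polycyclicGens G
  refine isRationalExtension_of_hasInvariants hx G ρ hρ π _ hG hG'
    (card_sublistProds_polycyclicGens i)
    (hasInvariants_polycyclicGens (hx.comp π π.injective) ?_ i)
  rw [π.surjective.range_comp, hgen]
end
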